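/- For every real number t, set s = 1/2 + i t. Then the Riemann xi value ξ(s) := (1/2) s (s−1) π^{−s/2} Γ(s/2) ζ(s) is a real number, and Re( π^{−s/2} Γ(s/2) R(s) ) = − Re(ξ(1/2 + i t)) / (1/4 + t²), where R is Riemann's auxiliary function. (In Riemann's notation Ξ(t) = ξ(1/2+it), this reads −Ξ(t)/(1/4 + t²) = Re{π^{−s/2} Γ(s/2) R(s)}.) -/

import Mathlib

open MeasureTheory

/-- The straight line of slope 1 crossing the real axis at `1/2`,
parametrized from upper right to lower left. -/
noncomputable def rline (u : ℝ) : ℂ :=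
  1 / 2 - Complex.exp (Real.pi * Complex.I / 4) * (u : ℂ)

/-- Riemann's auxiliary function
`R(s) = ∫_{0↙1} x^{-s} e^{πix²}/(e^{πix} − e^{-πix}) dx`, written out as an
integral over the real parameter of the line `0↙1`. Here `z ^ (-s)` is the
principal power `exp (−s Log z)`. -/
noncomputable def RiemannR (s : ℂ) : ℂ :=
  -Complex.exp (Real.pi * Complex.I / 4) *
    ∫ u : ℝ, (rline u) ^ (-s) *
      Complex.exp (Real.pi * Complex.I * (rline u) ^ 2) /
      (Complex.exp (Real.pi * Complex.I * rline u) -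
        Complex.exp (-(Real.pi * Complex.I * rline u)))

open Complex Set Filter Topology in
/-- Holomorphic dependence on a parameter for exponential-type integrals. -/
lemma differentiableAt_integral_exp {α : Type*} [MeasurableSpace α] {μ : Measure α}
    (φ g : α → ℂ) (hφ : AEStronglyMeasurable φ μ) (hg : AEStronglyMeasurable g μ)
    (z₀ : ℂ) (ε : ℝ) (hε : 0 < ε) (bound : α → ℝ) (hb : Integrable bound μ)
    (h0 : Integrable (fun x => cexp (z₀ * φ x) * g x) μ)
    (hbd : ∀ᵐ x ∂μ, ∀ z ∈ Metric.ball z₀ ε, ‖cexp (z * φ x) * φ x * g x‖ ≤ bound x) :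
    DifferentiableAt ℂ (fun z => ∫ x, cexp (z * φ x) * g x ∂μ) z₀ := by
  have hm : ∀ z : ℂ, AEStronglyMeasurable (fun x => cexp (z * φ x)) μ := fun z =>
    Complex.continuous_exp.comp_aestronglyMeasurable (hφ.const_mul z)
  have := hasDerivAt_integral_of_dominated_loc_of_deriv_le (μ := μ)
    (F := fun z x => cexp (z * φ x) * g x) (F' := fun z x => cexp (z * φ x) * φ x * g x)
    (x₀ := z₀) (bound := bound) (Metric.ball_mem_nhds z₀ hε)
    (Eventually.of_forall fun z => (hm z).mul hg) h0 (((hm z₀).mul hφ).mul hg) hbd hb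
    (Eventually.of_forall fun x z _ => by
      have h1 : HasDerivAt (fun z : ℂ => z * φ x) (φ x) z := by
        simpa using (hasDerivAt_id z).mul_const (φ x)
      exact h1.cexp.mul_const (g x))
  exact this.2.differentiableAt

namespace RSaux

/-- `e^{iπ/4}` -/
noncomputable def om : ℂ := Complex.exp (Real.pi * Complex.I / 4)
/-- `e^{-iπ/4}` -/
noncomputable def omb : ℂ := Complex.exp (-(Real.pi * Complex.I / 4))
/-- the denominator -/
noncomputable def D (z : ℂ) : ℂ :=
  Complex.exp (Real.pi * Complex.I * z) - Complex.exp (-(Real.pi * Complex.I * z))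

lemma om_eq : om = (√2 / 2 : ℝ) + (√2 / 2 : ℝ) * Complex.I := by
  have : om = Complex.exp ((Real.pi / 4 : ℝ) * Complex.I) := by
    unfold om; congr 1; push_cast; ring
  rw [this, Complex.exp_mul_I, ← Complex.ofReal_cos, ← Complex.ofReal_sin, Real.cos_pi_div_four,
    Real.sin_pi_div_four]

lemma om_mul_omb : om * omb = 1 := by
  unfold om omb; rw [← Complex.exp_add]; simp

lemma omb_mul_om : omb * om = 1 := by rw [mul_comm, om_mul_omb]

lemma om_sq : om ^ 2 = Complex.I := by
  unfold om
  rw [← Complex.exp_nat_mul]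
  conv_rhs => rw [← Complex.exp_pi_div_two_mul_I]
  congr 1; push_cast; ring

lemma omb_eq_conj : omb = (starRingEnd ℂ) om := by
  unfold om omb
  rw [← Complex.exp_conj]; congr 1; simp [Complex.conj_ofNat, neg_div]

lemma omb_sq : omb ^ 2 = -Complex.I := by
  rw [omb_eq_conj, ← map_pow, om_sq, Complex.conj_I]

lemma omb_eq : omb = (√2 / 2 : ℝ) - (√2 / 2 : ℝ) * Complex.I := by
  rw [omb_eq_conj, om_eq]; simp [sub_eq_add_neg, Complex.conj_ofNat]

lemma om_re : om.re = √2 / 2 := by rw [om_eq]; simp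
lemma om_im : om.im = √2 / 2 := by rw [om_eq]; simp
lemma omb_re : omb.re = √2 / 2 := by rw [omb_eq]; simp
lemma omb_im : omb.im = -(√2 / 2) := by rw [omb_eq]; simp
lemma om_ne : om ≠ 0 := Complex.exp_ne_zero _
lemma omb_ne : omb ≠ 0 := Complex.exp_ne_zero _
lemma om_norm : ‖om‖ = 1 := by
  have : om = Complex.exp ((Real.pi / 4 : ℝ) * Complex.I) := by
    unfold om; congr 1; push_cast; ring
  rw [this, Complex.norm_exp_ofReal_mul_I]
lemma omb_norm : ‖omb‖ = 1 := by rw [omb_eq_conj, Complex.norm_conj, om_norm]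

lemma I_mul_om : Complex.I * om = -omb := by
  have h := om_mul_omb
  have h2 := omb_sq
  have : Complex.I = - omb^2 := by rw [h2]; ring
  rw [this]; linear_combination (-omb) * h

lemma I_mul_omb : Complex.I * omb = om := by
  have h := om_mul_omb
  rw [← om_sq]; linear_combination (om) * h

lemma D_neg (z : ℂ) : D (-z) = -D z := by
  unfold D; simp

lemma D_conj (z : ℂ) : (starRingEnd ℂ) (D z) = -D ((starRingEnd ℂ) z) := by
  unfold D
  rw [map_sub, ← Complex.exp_conj, ← Complex.exp_conj]
  simp

lemma D_sub_one (z : ℂ) : D (z - 1) = - D z := by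
  unfold D
  have h1 : Real.pi * Complex.I * (z - 1) = Real.pi * Complex.I * z - Real.pi * Complex.I := by ring
  have h2 : -(Real.pi * Complex.I * (z - 1)) = -(Real.pi * Complex.I * z) + Real.pi * Complex.I := by ring
  rw [h2, h1, Complex.exp_sub, Complex.exp_add, Complex.exp_pi_mul_I]; ring

lemma D_differentiable : Differentiable ℂ D := by unfold D; fun_prop
lemma D_continuous : Continuous D := D_differentiable.continuous

lemma D_norm_ge (z : ℂ) : 2 * Real.pi * |z.im| ≤ ‖D z‖ := by
  have h := abs_norm_sub_norm_le (Complex.exp (Real.pi * Complex.I * z))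
    (Complex.exp (-(Real.pi * Complex.I * z)))
  rw [Complex.norm_exp, Complex.norm_exp] at h
  have e : (Real.pi * Complex.I * z).re = -(Real.pi * z.im) := by simp
  rw [Complex.neg_re, e, neg_neg] at h
  refine le_trans ?_ h
  have h2 : Real.exp (-(Real.pi * z.im)) - Real.exp (Real.pi * z.im)
      = -2 * Real.sinh (Real.pi * z.im) := by rw [Real.sinh_eq]; ring
  rw [h2, abs_mul, Real.abs_sinh]
  have := Real.self_le_sinh_iff.2 (abs_nonneg (Real.pi * z.im))
  rw [abs_mul, abs_of_pos Real.pi_pos] at this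
  rw [abs_mul, abs_of_pos Real.pi_pos]
  norm_num; nlinarith

lemma D_zero_iff {z : ℂ} (h : D z = 0) : ∃ n : ℤ, z = n := by
  unfold D at h
  rw [sub_eq_zero, Complex.exp_eq_exp_iff_exists_int] at h
  obtain ⟨n, hn⟩ := h
  refine ⟨n, ?_⟩
  have hp : (Real.pi : ℂ) ≠ 0 := by exact_mod_cast Real.pi_ne_zero
  have : (2 * Real.pi * Complex.I) * z = (2 * Real.pi * Complex.I) * n := by linear_combination hn
  exact mul_left_cancel₀ (by simp [hp]) this

lemma rline_eq (u : ℝ) : rline u = 1 / 2 - om * u := rfl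

lemma rline_re (u : ℝ) : (rline u).re = 1/2 - √2/2 * u := by
  rw [rline_eq]; simp [om_re, om_im]
lemma rline_im (u : ℝ) : (rline u).im = - (√2/2 * u) := by
  rw [rline_eq]; simp [om_re, om_im]

lemma D_rline_ge (u : ℝ) : 2 ≤ ‖D (rline u)‖ := by
  have e : D (rline u) = 2 * Complex.I * Complex.sin (Real.pi * rline u) := by
    unfold D
    rw [Complex.sin]
    have h1 : -(Real.pi * rline u) * Complex.I = -(Real.pi * Complex.I * rline u) := by ring
    have h2 : (Real.pi * rline u) * Complex.I = (Real.pi * Complex.I * rline u) := by ring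
    rw [h1, h2]; 
    linear_combination (-(Complex.exp (-(Real.pi * Complex.I * rline u)) -
      Complex.exp (Real.pi * Complex.I * rline u))) * Complex.I_sq
  set y := Real.pi * (√2/2 * u) with hy
  have e2 : Real.pi * rline u = (Real.pi / 2 - y : ℝ) + (-y : ℝ) * Complex.I := by
    apply Complex.ext
    · simp [rline_re, rline_im, hy]; ring
    · simp [rline_re, rline_im, hy]
  rw [e, e2, Complex.sin_add_mul_I, ← Complex.ofReal_sin, ← Complex.ofReal_cos,
    ← Complex.ofReal_sinh, ← Complex.ofReal_cosh, Real.sin_pi_div_two_sub, Real.cos_pi_div_two_sub]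
  have h3 : 1 ≤ ‖((Real.cos y : ℂ) * (Real.cosh (-y) : ℝ) + (Real.sin y : ℝ) * (Real.sinh (-y) : ℝ) * Complex.I)‖ := by
    have hsq : ‖((Real.cos y : ℂ) * (Real.cosh (-y) : ℝ) + (Real.sin y : ℝ) * (Real.sinh (-y) : ℝ) * Complex.I)‖ ^ 2
        = (Real.cos y * Real.cosh y) ^ 2 + (Real.sin y * Real.sinh y) ^ 2 := by
      rw [← Complex.normSq_eq_norm_sq, Complex.normSq_apply, Real.cosh_neg, Real.sinh_neg]
      simp [-Complex.ofReal_cos, -Complex.ofReal_sin, -Complex.ofReal_cosh, -Complex.ofReal_sinh]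
      ring
    have h4 : Real.sin y ^ 2 ≤ Real.sinh y ^ 2 := by
      rw [sq_le_sq, Real.abs_sinh]
      exact le_trans (Real.abs_sin_le_abs) (Real.self_le_sinh_iff.2 (abs_nonneg _))
    have h5 := Real.cosh_sq y
    have h6 := Real.sin_sq_add_cos_sq y
    have : 1 ≤ (Real.cos y * Real.cosh y) ^ 2 + (Real.sin y * Real.sinh y) ^ 2 := by
      have : (Real.cos y * Real.cosh y) ^ 2 + (Real.sin y * Real.sinh y) ^ 2
        = Real.cos y ^ 2 + Real.sinh y ^ 2 := by
        rw [mul_pow, mul_pow, h5]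
        linear_combination (Real.sinh y ^ 2) * h6
      rw [this]; linarith
    rw [← hsq] at this
    nlinarith [norm_nonneg ((Real.cos y : ℂ) * (Real.cosh (-y) : ℝ) + (Real.sin y : ℝ) * (Real.sinh (-y) : ℝ) * Complex.I)]
  rw [norm_mul]
  have : ‖2 * Complex.I‖ = 2 := by simp
  rw [this]; linarith

end RSaux
namespace RSaux
open Complex Set Filter Topology

lemma line_shift (f : ℂ → ℂ) (c₁ c₂ : ℝ) (hcc : c₁ ≤ c₂)
    (hc : ContinuousOn f {z | c₁ ≤ z.im ∧ z.im ≤ c₂})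
    (hd : DifferentiableOn ℂ f {z | c₁ < z.im ∧ z.im < c₂})
    (b : ℝ → ℝ) (hb : Tendsto b atTop (𝓝 0))
    (h1 : ∀ T : ℝ, 1 ≤ T → ∀ y : ℝ, c₁ ≤ y → y ≤ c₂ → ‖f ((T : ℂ) + y * I)‖ ≤ b T)
    (h2 : ∀ T : ℝ, 1 ≤ T → ∀ y : ℝ, c₁ ≤ y → y ≤ c₂ → ‖f ((-T : ℝ) + y * I)‖ ≤ b T)
    (i1 : Integrable (fun x : ℝ => f (x + c₁ * I)))
    (i2 : Integrable (fun x : ℝ => f (x + c₂ * I))) :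
    ∫ x : ℝ, f (x + c₁ * I) = ∫ x : ℝ, f (x + c₂ * I) := by
  have t1 := intervalIntegral_tendsto_integral i1 tendsto_neg_atTop_atBot tendsto_id
  have t2 := intervalIntegral_tendsto_integral i2 tendsto_neg_atTop_atBot tendsto_id
  have t3 := t1.sub t2
  have key : ∀ T : ℝ, 1 ≤ T → ‖(∫ x : ℝ in -T..T, f (x + c₁ * I)) - ∫ x : ℝ in -T..T, f (x + c₂ * I)‖
      ≤ 2 * (c₂ - c₁) * b T := by
    intro T hT
    have hTT : -T ≤ T := by linarith
    have C := integral_boundary_rect_eq_zero_of_continuousOn_of_differentiableOn f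
      (⟨-T, c₁⟩ : ℂ) (⟨T, c₂⟩ : ℂ)
      (hc.mono (by
        rintro z ⟨_, hz⟩
        simp only [mem_preimage, uIcc_of_le hcc] at hz
        exact hz))
      (hd.mono (by
        rintro z ⟨_, hz⟩
        simp only [mem_preimage, min_eq_left hcc, max_eq_right hcc] at hz
        exact hz))
    simp only at C
    have v1 : ‖∫ y : ℝ in c₁..c₂, f ((T : ℂ) + y * I)‖ ≤ b T * |c₂ - c₁| := by
      apply intervalIntegral.norm_integral_le_of_norm_le_const
      intro y hy
      rw [uIoc_of_le hcc] at hy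
      exact h1 T hT y hy.1.le hy.2
    have v2 : ‖∫ y : ℝ in c₁..c₂, f ((-T : ℝ) + y * I)‖ ≤ b T * |c₂ - c₁| := by
      apply intervalIntegral.norm_integral_le_of_norm_le_const
      intro y hy
      rw [uIoc_of_le hcc] at hy
      exact h2 T hT y hy.1.le hy.2
    rw [abs_of_nonneg (by linarith)] at v1 v2
    have e : (∫ x : ℝ in -T..T, f (x + c₁ * I)) - ∫ x : ℝ in -T..T, f (x + c₂ * I)
        = I • (∫ y : ℝ in c₁..c₂, f ((-T : ℝ) + y * I)) - I • ∫ y : ℝ in c₁..c₂, f ((T : ℂ) + y * I) := by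
      linear_combination C
    rw [e]
    refine (norm_sub_le _ _).trans ?_
    rw [norm_smul, norm_smul, Complex.norm_I]
    linarith
  have t4 : Tendsto (fun T : ℝ => (∫ x : ℝ in -T..T, f (x + c₁ * I)) - ∫ x : ℝ in -T..T, f (x + c₂ * I))
      atTop (𝓝 0) := by
    apply squeeze_zero_norm' (a := fun T => 2 * (c₂ - c₁) * b T)
    · filter_upwards [eventually_ge_atTop 1] with T hT using key T hT
    · simpa using hb.const_mul (2 * (c₂ - c₁))
  exact sub_eq_zero.1 (tendsto_nhds_unique t3 t4)

lemma gauss_tendsto (B C : ℝ) :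
    Tendsto (fun T : ℝ => Real.exp (-Real.pi * T ^ 2 + B * T + C)) atTop (𝓝 0) := by
  apply Real.tendsto_exp_atBot.comp
  have h : Tendsto (fun T : ℝ => T * (B - Real.pi * T) + C) atTop atBot := by
    apply tendsto_atBot_add_const_right
    apply Tendsto.atTop_mul_atBot₀ tendsto_id
    have h3 : Tendsto (fun T : ℝ => B + -(Real.pi * T)) atTop atBot :=
      tendsto_atBot_add_const_left _ _
        (tendsto_neg_atTop_atBot.comp (tendsto_id.const_mul_atTop Real.pi_pos))
    exact h3.congr (fun x => (sub_eq_add_neg _ _).symm)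
  exact h.congr (fun T => by ring)

lemma integral_lorentz (a : ℝ) (ha : 0 < a) :
    Integrable (fun x : ℝ => a / (x ^ 2 + a ^ 2)) ∧ ∫ x : ℝ, a / (x ^ 2 + a ^ 2) = Real.pi := by
  have e : (fun x : ℝ => a / (x ^ 2 + a ^ 2)) = fun x => a⁻¹ * (1 + (x / a) ^ 2)⁻¹ := by
    ext x
    have : x ^ 2 + a ^ 2 ≠ 0 := by positivity
    have : 1 + (x / a) ^ 2 ≠ 0 := by positivity
    field_simp
    ring
  rw [e]
  constructor
  · exact (integrable_inv_one_add_sq.comp_div ha.ne').const_mul _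
  · rw [integral_const_mul, Measure.integral_comp_div (fun y => (1 + y ^ 2)⁻¹),
      integral_univ_inv_one_add_sq, abs_of_pos ha, smul_eq_mul]
    field_simp

/-- comparison kernel with a simple pole at `0` -/
noncomputable def ker (z : ℂ) : ℂ := 4 / (z * (z ^ 2 + 4))

lemma ker_den (x y : ℝ) (hy : |y| ≤ 1) : 1 + x ^ 2 ≤ ‖((x : ℂ) + y * I) ^ 2 + 4‖ := by
  have e : ((x : ℂ) + y * I) ^ 2 + 4 = ((x : ℂ) + (y + 2 : ℝ) * I) * ((x : ℂ) + (y - 2 : ℝ) * I) := by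
    push_cast; linear_combination (4) * I_sq
  rw [e, norm_mul]
  rw [abs_le] at hy
  have n1 : ∀ y : ℝ, 1 ≤ y ^ 2 → √(1 + x ^ 2) ≤ ‖(x : ℂ) + (y : ℝ) * I‖ := by
    intro y hy
    rw [Complex.norm_add_mul_I]
    apply Real.sqrt_le_sqrt; linarith
  have h1 := n1 (y + 2) (by nlinarith)
  have h2 := n1 (y - 2) (by nlinarith)
  have h3 : √(1 + x ^ 2) * √(1 + x ^ 2) = 1 + x ^ 2 := Real.mul_self_sqrt (by positivity)
  have := mul_le_mul h1 h2 (Real.sqrt_nonneg _) (norm_nonneg _)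
  linarith

lemma line_ne_zero (x y : ℝ) (hy : y ≠ 0) : (x : ℂ) + y * I ≠ 0 := by
  intro h; apply hy; simpa using congrArg Complex.im h

lemma ker_integrable (y : ℝ) (hy : |y| ≤ 1) (hy0 : y ≠ 0) :
    Integrable (fun x : ℝ => ker (x + y * I)) := by
  have h0 : ∀ x : ℝ, ((x : ℂ) + y * I) ^ 2 + 4 ≠ 0 := by
    intro x h
    have := ker_den x y hy
    rw [h, norm_zero] at this; nlinarith [sq_nonneg x]
  refine Integrable.mono' (g := fun x : ℝ => (4 / |y|) * (1 + x ^ 2)⁻¹)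
    (integrable_inv_one_add_sq.const_mul _) ?_ ?_
  · apply Continuous.aestronglyMeasurable
    unfold ker
    apply continuous_const.div (by fun_prop)
    intro x
    exact mul_ne_zero (line_ne_zero x y hy0) (h0 x)
  · refine Eventually.of_forall fun x => ?_
    have h1 := ker_den x y hy
    have h2 : |y| ≤ ‖(x : ℂ) + y * I‖ := by
      have := Complex.abs_im_le_norm ((x : ℂ) + y * I)
      simpa using this
    unfold ker
    rw [norm_div, norm_mul]
    have hyp : 0 < |y| := abs_pos.2 hy0
    have : (4 / |y|) * (1 + x ^ 2)⁻¹ = 4 / (|y| * (1 + x ^ 2)) := by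
      field_simp
    rw [this]
    norm_num
    gcongr

lemma ker_diff (h : ℝ) (h0 : 0 < h) (h1 : h ≤ 1) :
    (∫ x : ℝ, ker (x + (-h : ℝ) * I)) - ∫ x : ℝ, ker (x + h * I) = 2 * Real.pi * I := by
  rw [← integral_sub (ker_integrable (-h) (by rw [abs_neg, abs_of_pos h0]; exact h1) (by linarith))
    (ker_integrable h (by rw [abs_of_pos h0]; exact h1) h0.ne')]
  have e : ∀ x : ℝ, ker (x + (-h : ℝ) * I) - ker (x + h * I) =
      2 * I * ((h / (x ^ 2 + h ^ 2) : ℝ) : ℂ) + I * (((2 - h) / (x ^ 2 + (2 - h) ^ 2) : ℝ) : ℂ)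
        - I * (((2 + h) / (x ^ 2 + (2 + h) ^ 2) : ℝ) : ℂ) := by
    intro x
    have pf : ∀ y : ℝ, y ≠ 0 → |y| ≤ 1 → ker (x + y * I) = (↑x + ↑y * I)⁻¹ -
        (1/2) * ((↑x + ((y + 2 : ℝ) : ℂ) * I)⁻¹ + (↑x + ((y - 2 : ℝ) : ℂ) * I)⁻¹) := by
      intro y hy hy1
      rw [abs_le] at hy1
      have a1 := line_ne_zero x y hy
      have a2 := line_ne_zero x (y + 2) (by linarith)
      have a3 := line_ne_zero x (y - 2) (by linarith)
      have b2 : (x : ℂ) + (y + 2 : ℝ) * I = (x + y * I) + 2 * I := by push_cast; ring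
      have b3 : (x : ℂ) + (y - 2 : ℝ) * I = (x + y * I) - 2 * I := by push_cast; ring
      rw [b2] at a2 ⊢
      rw [b3] at a3 ⊢
      generalize (x : ℂ) + y * I = A at *
      unfold ker
      have a4 : A ^ 2 + 4 = (A + 2 * I) * (A - 2 * I) := by linear_combination 4 * I_sq
      rw [a4]
      field_simp
      ring_nf
      simp only [I_sq]
      ring
    have pinv : ∀ y : ℝ, y ≠ 0 → ((x : ℂ) + y * I)⁻¹ = (x - y * I) / ((x ^ 2 + y ^ 2 : ℝ) : ℂ) := by
      intro y hy
      have a1 := line_ne_zero x y hy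
      have a2 : ((x ^ 2 + y ^ 2 : ℝ) : ℂ) ≠ 0 := by
        have : x ^ 2 + y ^ 2 ≠ 0 := by positivity
        exact_mod_cast this
      rw [inv_eq_one_div, div_eq_div_iff a1 a2]
      push_cast
      linear_combination y ^ 2 * I_sq
    rw [pf (-h) (by linarith) (by rw [abs_neg, abs_of_pos h0]; exact h1),
      pf h h0.ne' (by rw [abs_of_pos h0]; exact h1), pinv _ (by linarith), pinv _ (by linarith),
      pinv _ (by linarith), pinv _ (by linarith), pinv _ (by linarith), pinv _ (by linarith)]
    have s1 : x ^ 2 + (-h) ^ 2 = x ^ 2 + h ^ 2 := by ring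
    have s2 : x ^ 2 + (-h + 2) ^ 2 = x ^ 2 + (2 - h) ^ 2 := by ring
    have s3 : x ^ 2 + (-h - 2) ^ 2 = x ^ 2 + (2 + h) ^ 2 := by ring
    have s4 : x ^ 2 + (h + 2) ^ 2 = x ^ 2 + (2 + h) ^ 2 := by ring
    have s5 : x ^ 2 + (h - 2) ^ 2 = x ^ 2 + (2 - h) ^ 2 := by ring
    rw [s1, s2, s3, s4, s5]
    simp only [Complex.ofReal_div]
    push_cast
    ring
  simp_rw [e]
  have L1 := integral_lorentz h h0
  have L2 := integral_lorentz (2 - h) (by linarith)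
  have L3 := integral_lorentz (2 + h) (by linarith)
  have j1 := (L1.1.ofReal (𝕜 := ℂ)).const_mul (2 * I)
  have j2 := (L2.1.ofReal (𝕜 := ℂ)).const_mul I
  have j3 := (L3.1.ofReal (𝕜 := ℂ)).const_mul I
  simp only [coe_algebraMap] at j1 j2 j3
  have j12 : Integrable (fun x : ℝ => 2 * I * ((h / (x ^ 2 + h ^ 2) : ℝ) : ℂ) +
      I * (((2 - h) / (x ^ 2 + (2 - h) ^ 2) : ℝ) : ℂ)) := j1.add j2
  rw [integral_sub j12 j3, integral_add j1 j2, integral_const_mul, integral_const_mul,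
    integral_const_mul]
  rw [integral_complex_ofReal, integral_complex_ofReal, integral_complex_ofReal, L1.2, L2.2, L3.2]
  ring

end RSaux
namespace RSaux
open Complex Set Filter Topology

/-- the conjugate line -/
noncomputable def cl (w : ℝ) : ℂ := 1 / 2 - omb * w

lemma cl_eq_conj (w : ℝ) : cl w = (starRingEnd ℂ) (rline w) := by
  rw [rline_eq]; unfold cl; rw [omb_eq_conj]; simp [Complex.conj_ofNat]

lemma D_cl_ge (w : ℝ) : 2 ≤ ‖D (cl w)‖ := by
  have h := D_rline_ge w
  rw [cl_eq_conj, ← norm_neg, ← D_conj, Complex.norm_conj]; exact h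

lemma cl_continuous : Continuous cl := by unfold cl; fun_prop

lemma D_cl_ne (w : ℝ) : D (cl w) ≠ 0 := by
  intro h; have := D_cl_ge w; rw [h, norm_zero] at this; linarith

lemma D_rline_ne (w : ℝ) : D (rline w) ≠ 0 := by
  intro h; have := D_rline_ge w; rw [h, norm_zero] at this; linarith

/-- Mordell integrand -/
noncomputable def F (u x : ℂ) : ℂ :=
  cexp (-(Real.pi * I * x ^ 2) + 2 * Real.pi * I * u * x) / D x

lemma F_exponent (u : ℂ) (w : ℝ) :
    -(Real.pi * I * (cl w) ^ 2) + 2 * Real.pi * I * u * (cl w) =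
      -(Real.pi : ℂ) * w ^ 2 + (Real.pi * I * omb * (1 - 2 * u)) * w + (Real.pi * I * u - Real.pi * I / 4) := by
  unfold cl
  linear_combination (-(Real.pi * I * w ^ 2)) * omb_sq + Real.pi * w ^ 2 * I_sq

lemma num_integrable (u : ℂ) : Integrable (fun w : ℝ =>
    cexp (-(Real.pi * I * (cl w) ^ 2) + 2 * Real.pi * I * u * (cl w))) := by
  simp_rw [F_exponent]
  exact integrable_cexp_quadratic (by simpa using Real.pi_pos) _ _

lemma F_integrable (u : ℂ) : Integrable (fun w : ℝ => F u (cl w)) := by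
  unfold F
  simp_rw [div_eq_mul_inv]
  refine (num_integrable u).mul_bdd (c := 1 / 2) ?_ ?_
  · apply Continuous.aestronglyMeasurable
    exact (D_continuous.comp cl_continuous).inv₀ D_cl_ne
  · refine Eventually.of_forall fun w => ?_
    rw [norm_inv, ← one_div]
    exact one_div_le_one_div_of_le two_pos (D_cl_ge w)

noncomputable def M (u : ℂ) : ℂ := ∫ w : ℝ, F u (cl w)

lemma M_diff (u : ℂ) : M (u + 1) - M u = cexp (Real.pi * I * (u + 1 / 2) ^ 2) := by
  unfold M
  rw [← integral_sub (F_integrable _) (F_integrable _)]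
  have e : ∀ w : ℝ, F (u + 1) (cl w) - F u (cl w) =
      cexp (-(Real.pi : ℂ) * w ^ 2 + (Real.pi * I * omb * (1 - 2 * (u + 1 / 2))) * w +
        (Real.pi * I * (u + 1 / 2) - Real.pi * I / 4)) := by
    intro w
    rw [← F_exponent]
    have h := D_cl_ne w
    unfold F
    rw [← sub_div, div_eq_iff h]
    unfold D
    rw [mul_sub, ← Complex.exp_add, ← Complex.exp_add]
    congr 2 <;> ring
  simp_rw [e]
  have hp : (Real.pi : ℂ) ≠ 0 := by exact_mod_cast Real.pi_ne_zero
  rw [integral_cexp_quadratic (by simpa using Real.pi_pos)]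
  rw [neg_neg, div_self hp, Complex.one_cpow, one_mul]
  congr 1
  have hc : (Real.pi * I * omb * (1 - 2 * (u + 1 / 2))) ^ 2 =
      Real.pi ^ 2 * I * (1 - 2 * (u + 1 / 2)) ^ 2 := by
    rw [mul_pow, mul_pow, mul_pow, omb_sq, I_sq]; ring
  rw [hc]
  field_simp
  ring

lemma F_sub_one (u x : ℂ) : F u (x - 1) = cexp (-(2 * Real.pi * I * u)) * F (u + 1) x := by
  unfold F
  have : -(Real.pi * I * (x - 1) ^ 2) + 2 * Real.pi * I * u * (x - 1)
     = (-(2 * Real.pi * I * u) + (-(Real.pi * I * x ^ 2) + 2 * Real.pi * I * (u + 1) * x)) - Real.pi * I := by ring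
  rw [D_sub_one, this, Complex.exp_sub, Complex.exp_pi_mul_I, Complex.exp_add, div_neg, div_neg, neg_div,
    neg_neg, div_one, mul_div_assoc]

/-- the shift `h = √2/4`  -/
noncomputable def hh : ℝ := √2 / 4

lemma hh_pos : 0 < hh := by unfold hh; positivity
lemma hh_lt : hh < 3 / 8 := by
  unfold hh
  have : √2 < 1.5 := by rw [Real.sqrt_lt' (by norm_num)]; norm_num
  linarith
lemma om_half : om / 2 = hh + hh * I := by
  rw [om_eq]; unfold hh; push_cast; ring
lemma omb_half : omb / 2 = hh - hh * I := by
  rw [omb_eq]; unfold hh; push_cast; ring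

lemma cl_a (x : ℝ) : -omb * ((x : ℂ) + (-hh : ℝ) * I) = cl (x + hh) := by
  unfold cl
  have h1 := om_half
  have h2 := omb_mul_om
  push_cast
  linear_combination (-omb) * h1 + (1 / 2) * h2

lemma cl_b (x : ℝ) : -omb * ((x : ℂ) + hh * I) = cl (x - hh) - 1 := by
  unfold cl
  have h1 := om_half
  have h2 := omb_mul_om
  push_cast
  linear_combination (omb) * h1 - (1 / 2) * h2

lemma abs_im_big (x y : ℝ) (hx : 1 ≤ |x|) (hy : |y| ≤ 3 / 8) (e : ℝ) (he : |e| = 1) :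
    1 ≤ 2 * Real.pi * |√2 / 2 * (y - e * x)| := by
  have h1 : 1.4 ≤ √2 := by rw [Real.le_sqrt' (by norm_num)]; norm_num
  have h2 : 3 < Real.pi := Real.pi_gt_three
  have h3 : 5 / 8 ≤ |y - e * x| := by
    have := abs_sub_abs_le_abs_sub (e * x) y
    rw [abs_mul, he, one_mul, abs_sub_comm] at this
    linarith
  rw [abs_mul, abs_of_pos (by positivity : (0:ℝ) < √2 / 2)]
  have h4 : 0.7 * (5 / 8) ≤ √2 / 2 * |y - e * x| := by
    apply mul_le_mul (by linarith) h3 (by norm_num) (by positivity)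
  nlinarith

lemma D_strip_ne {z : ℂ} (hz : |z.im| < 1 / 2) (h0 : z ≠ 0) : D (-omb * z) ≠ 0 := by
  intro h
  obtain ⟨n, hn⟩ := D_zero_iff h
  have e : z = -om * n := by
    rw [← hn]; linear_combination (-z) * om_mul_omb
  have hn0 : n ≠ 0 := by
    rintro rfl; apply h0; rw [e]; simp
  rw [e] at hz
  have him : (-om * (n : ℂ)).im = -(√2 / 2) * n := by simp [om_im]
  rw [him, abs_mul, abs_neg, abs_of_pos (by positivity : (0:ℝ) < √2 / 2)] at hz
  have h1 : 1.4 ≤ √2 := by rw [Real.le_sqrt' (by norm_num)]; norm_num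
  have h2 : (1 : ℝ) ≤ |(n : ℝ)| := by exact_mod_cast Int.one_le_abs hn0
  nlinarith

lemma F_rot_bound (u : ℂ) (x y : ℝ) (hx : 1 ≤ |x|) (hy : |y| ≤ 3 / 8) :
    ‖F u (-omb * (x + y * I))‖ ≤
      Real.exp (-Real.pi * |x| ^ 2 + (2 * Real.pi * ‖u‖) * |x| + (Real.pi + 2 * Real.pi * ‖u‖)) := by
  set z : ℂ := x + y * I with hz
  unfold F
  have hD : 1 ≤ ‖D (-omb * z)‖ := by
    refine le_trans ?_ (D_norm_ge _)
    have him : (-omb * z).im = - (√2 / 2 * (y - 1 * x)) := by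
      simp [hz, omb_re, omb_im]; ring
    rw [him, abs_neg]
    exact abs_im_big x y hx hy 1 (by simp)
  rw [norm_div, Complex.norm_exp]
  refine (div_le_self (Real.exp_nonneg _) hD).trans ?_
  apply Real.exp_le_exp.2
  rw [add_re]
  have e1 : (-(Real.pi * I * (-omb * z) ^ 2)).re = -Real.pi * (x ^ 2 - y ^ 2) := by
    have : -(Real.pi * I * (-omb * z) ^ 2) = ((-Real.pi : ℝ) : ℂ) * z ^ 2 := by
      push_cast
      linear_combination (-Real.pi * I * z ^ 2) * omb_sq + (Real.pi * z ^ 2) * I_sq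
    rw [this, Complex.re_ofReal_mul, hz]
    simp [pow_two]
  have hzn : ‖z‖ ≤ |x| + 1 := by
    refine (norm_add_le _ _).trans ?_
    rw [norm_mul, Complex.norm_I, Complex.norm_real, Complex.norm_real, Real.norm_eq_abs, Real.norm_eq_abs]
    linarith
  have e2 : (2 * Real.pi * I * u * (-omb * z)).re ≤ 2 * Real.pi * ‖u‖ * (|x| + 1) := by
    refine (Complex.re_le_norm _).trans ?_
    simp only [norm_mul, norm_neg, omb_norm, Complex.norm_I, Complex.norm_real, Real.norm_eq_abs,
      abs_of_pos Real.pi_pos, mul_one, one_mul, Complex.norm_ofNat]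
    gcongr
  rw [e1, sq_abs]
  have hy2 : y ^ 2 ≤ 1 := by rw [← sq_abs]; nlinarith [abs_nonneg y]
  nlinarith [Real.pi_pos]

lemma M_shift (u : ℂ) : M u - cexp (-(2 * Real.pi * I * u)) * M (u + 1) = -om := by
  have hp : (Real.pi : ℂ) ≠ 0 := by exact_mod_cast Real.pi_ne_zero
  set q : ℂ → ℂ := dslope (fun z => D (-omb * z)) 0 with hq
  set ρ : ℂ := (-(2 * Real.pi * I * omb))⁻¹ with hρ
  have q0 : q 0 = -(2 * Real.pi * I * omb) := by
    rw [hq, dslope_same]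
    apply HasDerivAt.deriv
    unfold D
    have h1 : HasDerivAt (fun z : ℂ => Real.pi * I * (-omb * z)) (Real.pi * I * (-omb * 1)) 0 :=
      ((hasDerivAt_id (0:ℂ)).const_mul _).const_mul _
    have := h1.cexp.sub h1.neg.cexp
    have e : cexp (Real.pi * I * (-omb * 0)) * (Real.pi * I * (-omb * 1)) -
      cexp ((-fun z : ℂ => Real.pi * I * (-omb * z)) 0) * -(Real.pi * I * (-omb * 1)) =
      -(2 * Real.pi * I * omb) := by
      simp only [Pi.neg_apply, mul_zero, neg_zero, Complex.exp_zero]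
      ring
    rw [e] at this
    exact this
  have hqz : ∀ z, z ≠ 0 → q z = D (-omb * z) / z := by
    intro z hz
    rw [hq, dslope_of_ne _ hz, slope_def_field]
    have : D 0 = 0 := by unfold D; simp
    simp [this]
  set S : Set ℂ := {z | |z.im| < 1 / 2} with hS
  have hSo : IsOpen S := isOpen_lt (by fun_prop) continuous_const
  have h0S : S ∈ 𝓝 (0 : ℂ) := hSo.mem_nhds (by simp [hS])
  have hqd : DifferentiableOn ℂ q S := by
    rw [hq, Complex.differentiableOn_dslope h0S]
    exact (D_differentiable.comp (by fun_prop : Differentiable ℂ fun z => -omb * z)).differentiableOn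
  have hqne : ∀ z ∈ S, q z ≠ 0 := by
    intro z hz
    by_cases h : z = 0
    · rw [h, q0]
      simp [hp, omb_ne]
    · rw [hqz z h]; exact div_ne_zero (D_strip_ne hz h) h
  have hden : ∀ z ∈ S, z ^ 2 + 4 ≠ 0 := by
    intro z hz h
    have := ker_den z.re z.im (by have : |z.im| < 1/2 := hz; linarith)
    rw [Complex.re_add_im, h, norm_zero] at this
    nlinarith [sq_nonneg z.re]
  set N : ℂ → ℂ := fun z => cexp (-(Real.pi * I * (-omb * z) ^ 2) + 2 * Real.pi * I * u * (-omb * z)) / q z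
    - 4 * ρ / (z ^ 2 + 4) with hN
  have hNd : DifferentiableOn ℂ N S := by
    apply DifferentiableOn.sub
    · apply DifferentiableOn.div _ hqd hqne
      fun_prop
    · apply DifferentiableOn.div (by fun_prop) (by fun_prop) hden
  have N0 : N 0 = 0 := by
    simp only [hN, q0, hρ]
    simp
  set f : ℂ → ℂ := dslope N 0 with hf
  have hfd : DifferentiableOn ℂ f S := (Complex.differentiableOn_dslope h0S).2 hNd
  have hfz : ∀ z, z ≠ 0 → f z = F u (-omb * z) - ρ * ker z := by
    intro z hz
    rw [hf, dslope_of_ne _ hz, slope_def_field, N0]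
    simp only [hN, sub_zero]
    rw [hqz z hz]
    unfold F ker
    rw [sub_div, div_div, div_mul_cancel₀ _ hz, mul_div_assoc', div_div]
    congr 1
    rw [mul_comm 4 ρ, mul_comm z]
  have hsub : {z : ℂ | -hh ≤ z.im ∧ z.im ≤ hh} ⊆ S := by
    rintro z ⟨h1, h2⟩
    have := hh_lt
    show |z.im| < 1 / 2
    rw [abs_lt]; constructor <;> linarith
  have hhne : (-hh : ℝ) ≠ 0 := by have := hh_pos; linarith
  have hh1 : |hh| ≤ 1 := by rw [abs_of_pos hh_pos]; linarith [hh_lt]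
  have ia : Integrable (fun x : ℝ => F u (-omb * ((x : ℂ) + (-hh : ℝ) * I))) := by
    simp_rw [cl_a]
    exact (F_integrable u).comp_add_right hh
  have ib : Integrable (fun x : ℝ => F u (-omb * ((x : ℂ) + hh * I))) := by
    simp_rw [cl_b, F_sub_one]
    exact ((F_integrable (u + 1)).const_mul _).comp_sub_right hh
  have ka := (ker_integrable (-hh) (by rw [abs_neg]; exact hh1) hhne).const_mul ρ
  have kb := (ker_integrable hh hh1 hh_pos.ne').const_mul ρ
  have fa : ∀ x : ℝ, f ((x : ℂ) + (-hh : ℝ) * I) = F u (-omb * ((x : ℂ) + (-hh : ℝ) * I))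
      - ρ * ker ((x : ℂ) + (-hh : ℝ) * I) := fun x => hfz _ (line_ne_zero x _ hhne)
  have fb : ∀ x : ℝ, f ((x : ℂ) + hh * I) = F u (-omb * ((x : ℂ) + hh * I))
      - ρ * ker ((x : ℂ) + hh * I) := fun x => hfz _ (line_ne_zero x _ hh_pos.ne')
  have bd : ∀ x : ℝ, 1 ≤ |x| → ∀ y : ℝ, -hh ≤ y → y ≤ hh → ‖f ((x : ℂ) + y * I)‖ ≤
      Real.exp (-Real.pi * |x| ^ 2 + (2 * Real.pi * ‖u‖) * |x| + (Real.pi + 2 * Real.pi * ‖u‖))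
        + ‖ρ‖ * (4 / |x|) := by
    intro x hx y hy1 hy2
    have hy : |y| ≤ 3 / 8 := by
      have := hh_lt
      rw [abs_le]; constructor <;> linarith
    have hx0 : x ≠ 0 := by rintro rfl; simp at hx; linarith
    have hne : (x : ℂ) + y * I ≠ 0 := by
      intro h; apply hx0; simpa using congrArg Complex.re h
    rw [hfz _ hne]
    refine (norm_sub_le _ _).trans ?_
    refine add_le_add (F_rot_bound u x y hx hy) ?_
    rw [norm_mul]
    apply mul_le_mul_of_nonneg_left _ (norm_nonneg _)
    unfold ker
    rw [norm_div, norm_mul]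
    have h1 := ker_den x y (by linarith)
    have h2 : |x| ≤ ‖(x : ℂ) + y * I‖ := by
      have := Complex.abs_re_le_norm ((x : ℂ) + y * I)
      simpa using this
    have hx' : 0 < |x| := by linarith
    simp only [Complex.norm_ofNat]
    apply div_le_div_of_nonneg_left (by norm_num) hx'
    calc |x| = |x| * 1 := by ring
      _ ≤ _ := by
        apply mul_le_mul h2 _ (by norm_num) (norm_nonneg _)
        nlinarith [sq_nonneg x]
  have main := line_shift f (-hh) hh (by linarith [hh_pos]) (hfd.continuousOn.mono hsub)
    (hfd.mono (fun z hz => hsub ⟨hz.1.le, hz.2.le⟩))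
    (fun T => Real.exp (-Real.pi * T ^ 2 + (2 * Real.pi * ‖u‖) * T + (Real.pi + 2 * Real.pi * ‖u‖))
        + ‖ρ‖ * (4 / T))
    (by
      have t1 := gauss_tendsto (2 * Real.pi * ‖u‖) (Real.pi + 2 * Real.pi * ‖u‖)
      have t2 : Tendsto (fun T : ℝ => ‖ρ‖ * (4 / T)) atTop (𝓝 (‖ρ‖ * 0)) :=
        (tendsto_const_nhds.div_atTop tendsto_id).const_mul _
      simpa using t1.add t2)
    (fun T hT y h1 h2 => by
      have := bd T (by rw [abs_of_pos (by linarith)]; exact hT) y h1 h2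
      rwa [abs_of_pos (by linarith : (0:ℝ) < T)] at this)
    (fun T hT y h1 h2 => by
      have := bd (-T) (by rw [abs_neg, abs_of_pos (by linarith)]; exact hT) y h1 h2
      rwa [abs_neg, abs_of_pos (by linarith : (0:ℝ) < T)] at this)
    (by simp_rw [fa]; exact ia.sub ka) (by simp_rw [fb]; exact ib.sub kb)
  simp_rw [fa, fb] at main
  rw [integral_sub ia ka, integral_sub ib kb, integral_const_mul, integral_const_mul] at main
  have kd := ker_diff hh hh_pos (by linarith [hh_lt])
  have ea : ∫ x : ℝ, F u (-omb * ((x : ℂ) + (-hh : ℝ) * I)) = M u := by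
    simp_rw [cl_a]
    exact integral_add_right_eq_self (fun w => F u (cl w)) hh
  have eb : ∫ x : ℝ, F u (-omb * ((x : ℂ) + hh * I)) = cexp (-(2 * Real.pi * I * u)) * M (u + 1) := by
    simp_rw [cl_b, F_sub_one]
    rw [integral_const_mul]
    congr 1
    exact integral_sub_right_eq_self (fun w => F (u + 1) (cl w)) hh
  rw [ea, eb] at main
  have hr : ρ * (2 * Real.pi * I) = -om := by
    rw [hρ]
    have := omb_mul_om
    rw [inv_mul_eq_iff_eq_mul₀ (by simp [hp, omb_ne])]
    linear_combination (-2 * Real.pi * I) * this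
  linear_combination main + ρ * kd + hr

lemma mordell (u : ℂ) : M u * (1 - cexp (-(2 * Real.pi * I * u))) =
    -om * (1 - cexp (Real.pi * I * u ^ 2 - Real.pi * I * u)) := by
  have h1 := M_diff u
  have h2 := M_shift u
  have h3 : cexp (-(2 * Real.pi * I * u)) * cexp (Real.pi * I * (u + 1 / 2) ^ 2) =
      om * cexp (Real.pi * I * u ^ 2 - Real.pi * I * u) := by
    unfold om
    rw [← Complex.exp_add, ← Complex.exp_add]
    congr 1; ring
  linear_combination h2 + cexp (-(2 * Real.pi * I * u)) * h1 + h3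

end RSaux
namespace RSaux
open Complex Set Filter Topology

lemma eq_of_real (f g : ℂ → ℂ) (hf : DifferentiableOn ℂ f {z | 0 < z.re})
    (hg : DifferentiableOn ℂ g {z | 0 < z.re}) (c : ℝ) (hc : 0 ≤ c)
    (h : ∀ x : ℝ, c < x → f x = g x) : ∀ z : ℂ, 0 < z.re → f z = g z := by
  have ho : IsOpen {z : ℂ | 0 < z.re} := isOpen_lt continuous_const Complex.continuous_re
  have hconv : Convex ℝ {z : ℂ | 0 < z.re} := convex_halfSpace_re_gt 0
  refine fun z hz => AnalyticOnNhd.eqOn_of_preconnected_of_frequently_eq (hf.analyticOnNhd ho)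
    (hg.analyticOnNhd ho) hconv.isPreconnected (z₀ := ((c + 1 : ℝ) : ℂ))
    (by show 0 < (((c + 1 : ℝ) : ℂ)).re; rw [ofReal_re]; linarith) ?_ hz
  have ht : Tendsto (fun x : ℝ => (x : ℂ)) (𝓝[≠] (c + 1)) (𝓝[≠] ((c + 1 : ℝ) : ℂ)) := by
    apply tendsto_nhdsWithin_of_tendsto_nhds_of_eventually_within
    · exact (Complex.continuous_ofReal.tendsto _).mono_left nhdsWithin_le_nhds
    · filter_upwards [self_mem_nhdsWithin] with x hx
      intro h
      exact hx (Complex.ofReal_injective h)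
  apply ht.frequently
  apply Eventually.frequently
  have : ∀ᶠ x in 𝓝 (c + 1), c < x := lt_mem_nhds (by linarith)
  filter_upwards [nhdsWithin_le_nhds this] with x hx using h x hx

lemma rpow_exp_integrable (a b : ℝ) (ha : -1 < a) (hb : 0 < b) :
    IntegrableOn (fun t : ℝ => t ^ a * Real.exp (-b * t)) (Ioi 0) := by
  have := integrableOn_rpow_mul_exp_neg_mul_rpow ha one_pos hb
  simpa using this

lemma norm_cpow_pos (t : ℝ) (ht : 0 < t) (a : ℝ) : ‖(t : ℂ) ^ (a : ℂ)‖ = t ^ a := by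
  rw [Complex.norm_cpow_eq_rpow_re_of_pos ht, ofReal_re]

lemma cpow_aesm (a : ℝ) :
    AEStronglyMeasurable (fun t : ℝ => (t : ℂ) ^ (a : ℂ)) (volume.restrict (Ioi 0)) := by
  apply ContinuousOn.aestronglyMeasurable _ measurableSet_Ioi
  intro t ht
  apply ContinuousAt.continuousWithinAt
  have h1 : ContinuousAt (fun z : ℂ => z ^ (a : ℂ)) (t : ℂ) :=
    continuousAt_cpow_const (Or.inl (by simpa using ht))
  exact ContinuousAt.comp (f := fun t : ℝ => (t : ℂ)) h1 Complex.continuous_ofReal.continuousAt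

lemma cpow_exp_integrable (a : ℝ) (ha : 0 < a) (r : ℂ) (hr : 0 < r.re) :
    IntegrableOn (fun t : ℝ => cexp (r * (-(t : ℂ))) * (t : ℂ) ^ (a : ℂ)) (Ioi 0) := by
  refine Integrable.mono' (rpow_exp_integrable a r.re (by linarith) hr) ?_ ?_
  · exact (Continuous.aestronglyMeasurable (by fun_prop)).mul (cpow_aesm a)
  · filter_upwards [ae_restrict_mem measurableSet_Ioi] with t ht
    rw [norm_mul, norm_cpow_pos t ht, Complex.norm_exp, mul_comm]
    apply le_of_eq; congr 2
    simp

lemma gamma_laplace (a : ℝ) (ha : 0 < a) (r : ℂ) (hr : 0 < r.re) :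
    ∫ t : ℝ in Ioi 0, cexp (r * (-(t : ℂ))) * (t : ℂ) ^ (a : ℂ) =
      r ^ (-((a : ℂ) + 1)) * Complex.Gamma (a + 1) := by
  refine eq_of_real (fun r => ∫ t : ℝ in Ioi 0, cexp (r * (-(t : ℂ))) * (t : ℂ) ^ (a : ℂ))
    (fun r => r ^ (-((a : ℂ) + 1)) * Complex.Gamma (a + 1)) ?_ ?_ 0 le_rfl ?_ r hr
  · intro r hr
    have hr : 0 < r.re := hr
    apply DifferentiableAt.differentiableWithinAt
    refine differentiableAt_integral_exp (fun t : ℝ => -(t : ℂ)) (fun t : ℝ => (t : ℂ) ^ (a : ℂ))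
      (Continuous.aestronglyMeasurable (by fun_prop)) (cpow_aesm a) r (r.re / 2) (by linarith)
      (fun t => t ^ (a + 1) * Real.exp (-(r.re / 2) * t))
      (rpow_exp_integrable (a + 1) (r.re / 2) (by linarith) (by linarith))
      (cpow_exp_integrable a ha r hr) ?_
    filter_upwards [ae_restrict_mem measurableSet_Ioi] with t ht z hz
    have ht : 0 < t := ht
    rw [norm_mul, norm_mul, norm_cpow_pos t ht, Complex.norm_exp, norm_neg, Complex.norm_real,
      Real.norm_of_nonneg ht.le, Real.rpow_add_one ht.ne']
    have h1 : r.re / 2 ≤ z.re := by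
      rw [Metric.mem_ball, dist_eq_norm] at hz
      have := (Complex.abs_re_le_norm (z - r)).trans hz.le
      rw [abs_le, sub_re] at this
      linarith [this.1]
    have h2 : (z * -(t : ℂ)).re = -(z.re * t) := by simp
    rw [h2]
    have h3 : Real.exp (-(z.re * t)) ≤ Real.exp (-(r.re / 2) * t) := by
      apply Real.exp_le_exp.2; nlinarith
    have h4 : 0 ≤ t ^ a := Real.rpow_nonneg ht.le a
    calc Real.exp (-(z.re * t)) * t * t ^ a ≤ Real.exp (-(r.re / 2) * t) * t * t ^ a := by gcongr
      _ = _ := by ring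
  · apply DifferentiableOn.mul_const
    intro z hz
    apply DifferentiableAt.differentiableWithinAt
    exact DifferentiableAt.cpow_const differentiableAt_id (Or.inl hz)
  · intro x hx
    have := Complex.integral_cpow_mul_exp_neg_mul_Ioi (a := (a : ℂ) + 1) (r := x) (by simp; linarith) hx
    rw [Complex.cpow_neg, ← Complex.inv_cpow, ← one_div, ← this]
    · apply setIntegral_congr_fun measurableSet_Ioi
      intro t _
      beta_reduce
      rw [mul_comm, add_sub_cancel_right, mul_neg]
    · rw [Complex.arg_ofReal_of_nonneg hx.le]; exact Real.pi_pos.ne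

lemma om_cpow (b : ℂ) (x : ℂ) (hx0 : x ≠ 0) (hx : 0 ≤ x.re ∨ 0 ≤ x.im) :
    (2 * Real.pi * (omb * x)) ^ (-b) =
      (2 * Real.pi : ℂ) ^ (-b) * cexp (Real.pi * I / 4 * b) * x ^ (-b) := by
  have hp := Real.pi_pos
  have hpc : (Real.pi : ℂ) ≠ 0 := by exact_mod_cast Real.pi_ne_zero
  have h2p : (2 * Real.pi : ℂ) ≠ 0 := by simp [Real.pi_ne_zero]
  have h1 : -(Real.pi / 2) ≤ x.arg := Complex.neg_pi_div_two_le_arg_iff.2 hx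
  have h2 : x.arg ≤ Real.pi := Complex.arg_le_pi x
  have him : (Complex.log (2 * Real.pi) - Real.pi * I / 4 + Complex.log x).im =
      x.arg - Real.pi / 4 := by
    have e : (2 * Real.pi : ℂ) = ((2 * Real.pi : ℝ) : ℂ) := by push_cast; rfl
    have e2 : (Real.pi * I / 4 : ℂ) = ((Real.pi / 4 : ℝ) : ℂ) * I := by push_cast; ring
    rw [e, ← Complex.ofReal_log (by positivity), e2, Complex.add_im, Complex.sub_im,
      Complex.log_im, Complex.ofReal_im, Complex.mul_I_im, Complex.ofReal_re]
    ring
  have hl : Complex.log (2 * Real.pi * (omb * x)) =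
      Complex.log (2 * Real.pi) - Real.pi * I / 4 + Complex.log x := by
    rw [← Complex.log_exp (x := Complex.log (2 * Real.pi) - Real.pi * I / 4 + Complex.log x)
      (by rw [him]; linarith) (by rw [him]; linarith)]
    rw [Complex.exp_add, sub_eq_add_neg, Complex.exp_add, Complex.exp_log h2p, Complex.exp_log hx0]
    have : omb = cexp (-(Real.pi * I / 4)) := by
      unfold omb; congr 1
    congr 1; rw [this]; ring
  rw [Complex.cpow_def_of_ne_zero (mul_ne_zero h2p (mul_ne_zero omb_ne hx0)),
    Complex.cpow_def_of_ne_zero h2p, Complex.cpow_def_of_ne_zero hx0, hl, ← Complex.exp_add,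
    ← Complex.exp_add]
  congr 1; ring

lemma cl_re (w : ℝ) : (cl w).re = 1 / 2 - Real.sqrt 2 / 2 * w := by
  rw [cl_eq_conj, Complex.conj_re, rline_re]

lemma cl_im (w : ℝ) : (cl w).im = Real.sqrt 2 / 2 * w := by
  rw [cl_eq_conj, Complex.conj_im, rline_im, neg_neg]

lemma cl_ne (w : ℝ) : cl w ≠ 0 := by
  intro h
  have h1 := cl_re w
  have h2 := cl_im w
  rw [h] at h1 h2
  simp only [Complex.zero_re, Complex.zero_im] at h1 h2
  linarith

lemma cl_or (w : ℝ) : 0 ≤ (cl w).re ∨ 0 ≤ (cl w).im := by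
  rw [cl_re, cl_im]
  have : 0 < Real.sqrt 2 := by positivity
  rcases le_total 0 w with h | h
  · right; positivity
  · left; nlinarith

/-- Auxiliary: the zeta part. -/
lemma zeta_part (a : ℝ) (ha : 0 < a) :
    ∫ v : ℝ in Ioi 0, (v : ℂ) ^ (a : ℂ) * (1 - cexp (-(2 * Real.pi * I * (om * v))))⁻¹ =
      -((2 * Real.pi : ℂ) ^ (-((a : ℂ) + 1)) * cexp (Real.pi * I / 4 * ((a : ℂ) + 1)) *
        Complex.Gamma (a + 1) * riemannZeta (a + 1)) := by
  have hp := Real.pi_pos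
  set G : ℕ → ℝ → ℂ := fun n v =>
    cexp ((2 * Real.pi * (omb * ((n : ℂ) + 1))) * (-(v : ℂ))) * (v : ℂ) ^ (a : ℂ) with hG
  have hre : ∀ n : ℕ, (2 * Real.pi * (omb * ((n : ℂ) + 1))).re =
      2 * Real.pi * (Real.sqrt 2 / 2) * (n + 1) := by
    intro n
    have e : (2 * Real.pi * (omb * ((n : ℂ) + 1)) : ℂ) =
      ((2 * Real.pi * (n + 1) : ℝ) : ℂ) * omb := by push_cast; ring
    rw [e, Complex.re_ofReal_mul, omb_re]; ring
  have hpos : ∀ n : ℕ, 0 < (2 * Real.pi * (omb * ((n : ℂ) + 1))).re := by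
    intro n; rw [hre]; positivity
  have hintegr : ∀ n, Integrable (G n) (volume.restrict (Ioi 0)) := fun n =>
    cpow_exp_integrable a ha _ (hpos n)
  have hnorm : ∀ n, ∫ v : ℝ in Ioi 0, ‖G n v‖ =
      (2 * Real.pi * (Real.sqrt 2 / 2)) ^ (-(a + 1)) * Real.Gamma (a + 1) *
        (1 / ((n : ℝ) + 1) ^ (a + 1)) := by
    intro n
    have h1 : ∀ v ∈ Ioi (0 : ℝ), ‖G n v‖ =
        v ^ (a + 1 - 1) * Real.exp (-((2 * Real.pi * (Real.sqrt 2 / 2) * (n + 1)) * v)) := by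
      intro v hv
      rw [hG]
      beta_reduce
      rw [norm_mul, norm_cpow_pos v hv, Complex.norm_exp, mul_comm, add_sub_cancel_right, mul_neg,
        Complex.neg_re, Complex.re_mul_ofReal, hre]
    rw [setIntegral_congr_fun measurableSet_Ioi h1,
      Real.integral_rpow_mul_exp_neg_mul_Ioi (by linarith) (by positivity), one_div,
      Real.inv_rpow (by positivity), Real.mul_rpow (by positivity) (by positivity),
      Real.rpow_neg (by positivity)]
    field_simp
  have hsum : Summable fun n => ∫ v : ℝ in Ioi 0, ‖G n v‖ := by
    simp_rw [hnorm]
    apply Summable.mul_left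
    have := (summable_nat_add_iff 1).2 (Real.summable_one_div_nat_rpow.2 (by linarith : 1 < a + 1))
    simpa using this
  have key := (hasSum_integral_of_summable_integral_norm hintegr hsum).tsum_eq
  have hL : ∀ n : ℕ, ∫ v : ℝ in Ioi 0, G n v = ((2 * Real.pi : ℂ) ^ (-((a : ℂ) + 1)) *
      cexp (Real.pi * I / 4 * ((a : ℂ) + 1)) * Complex.Gamma (a + 1)) *
        (1 / ((n : ℂ) + 1) ^ ((a : ℂ) + 1)) := by
    intro n
    have e := gamma_laplace a ha _ (hpos n)
    rw [hG]
    beta_reduce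
    rw [e, om_cpow _ _ (Nat.cast_add_one_ne_zero n) (Or.inl (by simp; positivity)),
      Complex.cpow_neg ((n : ℂ) + 1), one_div]
    ring
  simp_rw [hL] at key
  rw [tsum_mul_left, ← zeta_eq_tsum_one_div_nat_add_one_cpow (by simp; linarith)] at key
  rw [key, ← integral_neg]
  apply setIntegral_congr_fun measurableSet_Ioi
  intro v hv
  have hv : 0 < v := hv
  beta_reduce
  set q : ℂ := cexp (2 * Real.pi * I * (om * v)) with hq
  have hqn : ‖q‖ < 1 := by
    rw [hq, Complex.norm_exp]
    have : (2 * Real.pi * I * (om * v) : ℂ) = ((2 * Real.pi * v : ℝ) : ℂ) * (-omb) := by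
      push_cast; rw [← I_mul_om]; ring
    rw [this, Complex.re_ofReal_mul, Complex.neg_re, omb_re, Real.exp_lt_one_iff]
    have : 0 < 2 * Real.pi * v * (Real.sqrt 2 / 2) := by positivity
    linarith
  have hGq : ∀ n, G n v = (v : ℂ) ^ (a : ℂ) * q * q ^ n := by
    intro n
    rw [hG]
    beta_reduce
    rw [mul_comm, mul_assoc ((v : ℂ) ^ (a : ℂ)), ← pow_succ', hq, ← Complex.exp_nat_mul]
    congr 2
    push_cast
    linear_combination (-(2 * Real.pi * (n + 1) * v : ℂ)) * I_mul_om
  simp_rw [hGq]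
  rw [tsum_mul_left, tsum_geometric_of_norm_lt_one hqn, Complex.exp_neg, ← hq]
  have hq0 : q ≠ 0 := Complex.exp_ne_zero _
  have hq1 : 1 - q ≠ 0 := by
    intro h
    rw [← sub_eq_zero.1 h] at hqn; simp at hqn
  have hq2 : 1 - q⁻¹ ≠ 0 := by
    intro h
    apply hq1
    have : q * (1 - q⁻¹) = 0 := by rw [h, mul_zero]
    rw [mul_sub, mul_inv_cancel₀ hq0] at this
    linear_combination -this
  have : (1 - q⁻¹)⁻¹ = -(q * (1 - q)⁻¹) := by
    rw [inv_eq_iff_eq_inv, inv_neg, mul_inv, inv_inv]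
    field_simp
    ring
  rw [this]; ring

end RSaux
namespace RSaux
open Complex Set Filter Topology

lemma omb_cl (w : ℝ) : omb * cl w = omb / 2 + I * w := by
  unfold cl
  linear_combination (-(w : ℂ)) * omb_sq

lemma F_om (v : ℝ) (x : ℂ) : F (om * v) x =
    cexp ((2 * Real.pi * (omb * x)) * (-(v : ℂ))) * (cexp (-(Real.pi * I * x ^ 2)) / D x) := by
  unfold F
  rw [← mul_div_assoc, ← Complex.exp_add]
  congr 2
  linear_combination (2 * Real.pi * v * x) * I_mul_om

lemma conj_R (b : ℝ) : (starRingEnd ℂ) (RiemannR b) =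
    omb * ∫ w : ℝ, (cl w) ^ (-(b : ℂ)) * (cexp (-(Real.pi * I * (cl w) ^ 2)) / D (cl w)) := by
  unfold RiemannR
  rw [map_mul, ← integral_conj, map_neg]
  change -((starRingEnd ℂ) om) * _ = _
  rw [← omb_eq_conj, neg_mul, ← mul_neg, ← integral_neg]
  congr 1
  apply integral_congr_ae
  refine Eventually.of_forall fun w => ?_
  beta_reduce
  change -(starRingEnd ℂ) ((rline w) ^ (-(b : ℂ)) * cexp (Real.pi * I * (rline w) ^ 2) / D (rline w)) = _
  rw [map_div₀, map_mul, D_conj, ← Complex.exp_conj, div_neg, neg_neg, cl_eq_conj, mul_div_assoc]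
  congr 1
  · rw [Complex.conj_cpow_eq_ite]
    have h : ¬ (rline w).arg = Real.pi := by
      intro h
      rw [Complex.arg_eq_pi_iff, rline_re, rline_im] at h
      have : Real.sqrt 2 ≠ 0 := by positivity
      have h3 : Real.sqrt 2 / 2 * w = 0 := by linarith [h.2]
      linarith [h.1]
    rw [if_neg h]
    simp
  · congr 2
    simp

lemma cl_sq_integrable : Integrable (fun w : ℝ => cexp (-(Real.pi * I * (cl w) ^ 2)) / D (cl w)) := by
  have := F_integrable 0
  unfold F at this
  simpa using this

lemma fubini_int (a : ℝ) (ha : 0 < a) : Integrable (fun p : ℝ × ℝ =>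
    (p.1 : ℂ) ^ (a : ℂ) * F (om * p.1) (cl p.2)) ((volume.restrict (Ioi 0)).prod volume) := by
  have h1 := cpow_exp_integrable a ha (Real.pi * omb) (by
    rw [Complex.re_ofReal_mul, omb_re]; have := Real.pi_pos; positivity)
  have h2 := Integrable.mul_prod h1 cl_sq_integrable
  have h3 := h2.mul_bdd (c := 1) (g := fun p : ℝ × ℝ => cexp ((-(2 * Real.pi * p.1 * p.2) : ℝ) * I))
    (Continuous.aestronglyMeasurable (by fun_prop))
    (Eventually.of_forall fun p => by rw [Complex.norm_exp_ofReal_mul_I])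
  refine h3.congr (Eventually.of_forall fun p => ?_)
  beta_reduce
  rw [F_om, omb_cl]
  have : (2 * Real.pi * (omb / 2 + I * p.2) * (-(p.1 : ℂ)) : ℂ) =
    (Real.pi * omb * (-(p.1 : ℂ))) + (-(2 * Real.pi * p.1 * p.2) : ℝ) * I := by push_cast; ring
  rw [this, Complex.exp_add]
  ring

lemma M_int (a : ℝ) (ha : 0 < a) :
    IntegrableOn (fun v : ℝ => (v : ℂ) ^ (a : ℂ) * M (om * v)) (Ioi 0) := by
  have h := (fubini_int a ha).integral_prod_left
  refine Integrable.congr h (Eventually.of_forall fun v => ?_)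
  beta_reduce
  unfold M
  rw [← integral_const_mul]

lemma M_part (a : ℝ) (ha : 0 < a) :
    ∫ v : ℝ in Ioi 0, (v : ℂ) ^ (a : ℂ) * M (om * v) =
      (2 * Real.pi : ℂ) ^ (-((a : ℂ) + 1)) * cexp (Real.pi * I / 4 * ((a : ℂ) + 1)) *
        Complex.Gamma (a + 1) * (om * (starRingEnd ℂ) (RiemannR (a + 1))) := by
  have e0 : ((a : ℂ) + 1) = ((a + 1 : ℝ) : ℂ) := by push_cast; rfl
  have e1 := conj_R (a + 1)
  rw [← e0] at e1
  rw [e1, ← mul_assoc om, om_mul_omb, one_mul, ← integral_const_mul]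
  unfold M
  simp_rw [← integral_const_mul]
  rw [integral_integral_swap (fubini_int a ha)]
  apply integral_congr_ae
  refine Eventually.of_forall fun w => ?_
  beta_reduce
  simp_rw [F_om]
  have : ∀ v : ℝ, (v : ℂ) ^ (a : ℂ) * (cexp (2 * Real.pi * (omb * cl w) * (-(v : ℂ))) *
      (cexp (-(Real.pi * I * (cl w) ^ 2)) / D (cl w))) =
      (cexp (2 * Real.pi * (omb * cl w) * (-(v : ℂ))) * (v : ℂ) ^ (a : ℂ)) *
      (cexp (-(Real.pi * I * (cl w) ^ 2)) / D (cl w)) := fun v => by ring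
  simp_rw [this]
  rw [integral_mul_const, gamma_laplace a ha, om_cpow _ _ (cl_ne w) (cl_or w)]
  · ring
  · rw [omb_cl]
    have : (2 * Real.pi * (omb / 2 + I * w) : ℂ) = (Real.pi : ℝ) * omb + ((2 * Real.pi * w : ℝ) : ℂ) * I := by
      push_cast; ring
    rw [this, Complex.add_re, Complex.re_ofReal_mul, omb_re]
    have := Real.pi_pos
    simp
    positivity

/-- the integral over the ray -/
noncomputable def J (a : ℝ) : ℂ :=
  ∫ v : ℝ in Ioi 0, (v : ℂ) ^ (a : ℂ) * (cexp (-(Real.pi * v ^ 2)) / D (om * v))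

lemma D_om_ge (v : ℝ) : Real.sqrt 2 * Real.pi * |v| ≤ ‖D (om * v)‖ := by
  have h := D_norm_ge (om * v)
  rw [Complex.im_mul_ofReal, om_im, abs_mul, abs_of_pos (by positivity : 0 < Real.sqrt 2 / 2)] at h
  linarith

lemma D_om_ne (v : ℝ) (hv : v ≠ 0) : D (om * v) ≠ 0 := by
  intro h
  have := D_om_ge v
  rw [h, norm_zero] at this
  have : 0 < Real.sqrt 2 * Real.pi * |v| := by
    have := Real.pi_pos
    have := abs_pos.2 hv
    positivity
  linarith

lemma J_int (a : ℝ) (ha : 0 < a) :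
    IntegrableOn (fun v : ℝ => (v : ℂ) ^ (a : ℂ) * (cexp (-(Real.pi * v ^ 2)) / D (om * v)))
      (Ioi 0) := by
  have hp := Real.pi_pos
  have h1 := (integrableOn_rpow_mul_exp_neg_mul_sq Real.pi_pos (s := a - 1) (by linarith)).const_mul
    (1 / (Real.sqrt 2 * Real.pi))
  refine Integrable.mono' h1 ?_ ?_
  · refine (cpow_aesm a).mul ?_
    apply ContinuousOn.aestronglyMeasurable _ measurableSet_Ioi
    apply ContinuousOn.div (Continuous.continuousOn (by fun_prop))
    · exact (D_continuous.comp (by fun_prop)).continuousOn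
    · intro v hv
      exact D_om_ne v (ne_of_gt hv)
  · filter_upwards [ae_restrict_mem measurableSet_Ioi] with v hv
    have hv : 0 < v := hv
    have hD := D_om_ge v
    rw [abs_of_pos hv] at hD
    rw [norm_mul, norm_cpow_pos v hv, norm_div, Complex.norm_exp]
    have e : (-(Real.pi * (v : ℂ) ^ 2)).re = -Real.pi * v ^ 2 := by
      rw [← ofReal_pow, ← ofReal_mul, ← ofReal_neg, ofReal_re]; ring
    rw [e, Real.rpow_sub_one hv.ne']
    have : Real.exp (-Real.pi * v ^ 2) / ‖D (om * v)‖ ≤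
      Real.exp (-Real.pi * v ^ 2) / (Real.sqrt 2 * Real.pi * v) := by gcongr
    have h4 : 0 ≤ v ^ a := Real.rpow_nonneg hv.le a
    calc _ ≤ v ^ a * (Real.exp (-Real.pi * v ^ 2) / (Real.sqrt 2 * Real.pi * v)) := by gcongr
      _ = _ := by field_simp

lemma mordell_ray (v : ℝ) (hv : 0 < v) : cexp (-(Real.pi * v ^ 2)) / D (om * v) =
    (1 - cexp (-(2 * Real.pi * I * (om * v))))⁻¹ + omb * M (om * v) := by
  have h := mordell (om * v)
  have hD := D_om_ne v hv.ne'
  set e := cexp (Real.pi * I * (om * v)) with he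
  have he0 : e ≠ 0 := Complex.exp_ne_zero _
  have e1 : cexp (-(2 * Real.pi * I * (om * v))) = e⁻¹ ^ 2 := by
    rw [he, ← Complex.exp_neg, ← Complex.exp_nat_mul]; congr 1; push_cast; ring
  have e2 : cexp (Real.pi * I * (om * v) ^ 2 - Real.pi * I * (om * v)) =
      cexp (-(Real.pi * v ^ 2)) * e⁻¹ := by
    rw [he, ← Complex.exp_neg, ← Complex.exp_add]; congr 1
    linear_combination (Real.pi * I * v ^ 2 : ℂ) * om_sq + (Real.pi * v ^ 2 : ℂ) * I_sq
  have e3 : D (om * v) = e - e⁻¹ := by unfold D; rw [Complex.exp_neg]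
  rw [e1, e2] at h
  have e4 : 1 - e⁻¹ ^ 2 = e⁻¹ * D (om * v) := by rw [e3]; field_simp
  rw [e1, e4]
  rw [e4] at h
  have h5 : omb * (M (om * v) * (e⁻¹ * D (om * v))) = -(1 - cexp (-(Real.pi * v ^ 2)) * e⁻¹) := by
    rw [h]; linear_combination (-(1 - cexp (-(Real.pi * v ^ 2)) * e⁻¹)) * omb_mul_om
  have h6 : e⁻¹ * D (om * v) ≠ 0 := mul_ne_zero (inv_ne_zero he0) hD
  apply mul_right_cancel₀ h6
  rw [add_mul, inv_mul_cancel₀ h6, mul_assoc, h5]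
  have h7 : D (om * v) * (D (om * v))⁻¹ = 1 := mul_inv_cancel₀ hD
  rw [div_eq_mul_inv]
  linear_combination (cexp (-(Real.pi * v ^ 2)) * e⁻¹) * h7

lemma J_eq (a : ℝ) (ha : 0 < a) : J a =
    (2 * Real.pi : ℂ) ^ (-((a : ℂ) + 1)) * cexp (Real.pi * I / 4 * ((a : ℂ) + 1)) *
        Complex.Gamma (a + 1) * ((starRingEnd ℂ) (RiemannR (a + 1)) - riemannZeta (a + 1)) := by
  have h1 := zeta_part a ha
  have h2 := M_part a ha
  have e : ∀ v ∈ Ioi (0 : ℝ), (v : ℂ) ^ (a : ℂ) * (1 - cexp (-(2 * Real.pi * I * (om * v))))⁻¹ =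
      (v : ℂ) ^ (a : ℂ) * (cexp (-(Real.pi * v ^ 2)) / D (om * v)) -
        omb * ((v : ℂ) ^ (a : ℂ) * M (om * v)) := by
    intro v hv
    rw [mordell_ray v hv]; ring
  rw [setIntegral_congr_fun measurableSet_Ioi e, integral_sub (J_int a ha)
    ((M_int a ha).const_mul omb), integral_const_mul, h2] at h1
  change J a - _ = _ at h1
  have := omb_mul_om
  set P := (2 * Real.pi : ℂ) ^ (-((a : ℂ) + 1)) * cexp (Real.pi * I / 4 * ((a : ℂ) + 1)) *
        Complex.Gamma (a + 1)
  linear_combination h1 + P * (starRingEnd ℂ) (RiemannR (a + 1)) * this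

end RSaux
namespace RSaux
open Complex Set Filter Topology

lemma gauss_int (A C : ℝ) :
    Integrable (fun x : ℝ => Real.exp (-Real.pi * x ^ 2 + A * |x| + C)) := by
  have h : ∀ B : ℝ, Integrable (fun x : ℝ => Real.exp (-Real.pi * x ^ 2 + B * x + C)) := by
    intro B
    have := (integrable_cexp_quadratic (b := (Real.pi : ℂ)) (by simpa using Real.pi_pos)
      (B : ℂ) (C : ℂ)).norm
    refine this.congr (Eventually.of_forall fun x => ?_)
    beta_reduce
    rw [Complex.norm_exp]
    congr 1
    have : (-(Real.pi : ℂ) * (x : ℂ) ^ 2 + B * x + C) = ((-Real.pi * x ^ 2 + B * x + C : ℝ) : ℂ) := by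
      push_cast; rfl
    rw [this, Complex.ofReal_re]
  refine Integrable.mono' ((h A).add (h (-A))) (Continuous.aestronglyMeasurable (by fun_prop))
    (Eventually.of_forall fun x => ?_)
  rw [Real.norm_of_nonneg (Real.exp_pos _).le]
  rw [Pi.add_apply]
  rcases abs_cases x with ⟨h, _⟩ | ⟨h, _⟩
  · rw [h]; linarith [Real.exp_pos (-Real.pi * x ^ 2 + (-A) * x + C)]
  · rw [h, mul_neg, ← neg_mul]; linarith [Real.exp_pos (-Real.pi * x ^ 2 + A * x + C)]

lemma rline_norm_ge (u : ℝ) : 1 / 4 ≤ ‖rline u‖ := by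
  have h1 := Complex.abs_re_le_norm (rline u)
  have h2 := Complex.abs_im_le_norm (rline u)
  have h3 : (rline u).re - (rline u).im = 1 / 2 := by rw [rline_re, rline_im]; ring
  have := le_abs_self (rline u).re
  have := neg_abs_le (rline u).im
  linarith

lemma rline_norm_le (u : ℝ) : ‖rline u‖ ≤ 1 + |u| := by
  rw [rline_eq]
  refine (norm_sub_le _ _).trans ?_
  rw [norm_mul, om_norm, Complex.norm_real, Real.norm_eq_abs]
  norm_num

lemma rline_ne (u : ℝ) : rline u ≠ 0 := by
  intro h; have := rline_norm_ge u; rw [h, norm_zero] at this; linarith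

lemma rline_slit (u : ℝ) : rline u ∈ slitPlane := by
  rw [Complex.mem_slitPlane_iff, rline_re, rline_im]
  by_cases h : u = 0
  · left; rw [h]; norm_num
  · right
    have : Real.sqrt 2 ≠ 0 := by positivity
    intro h3
    have h4 : Real.sqrt 2 / 2 * u = 0 := by linarith
    rcases mul_eq_zero.1 h4 with h5 | h5
    · apply this; linarith
    · exact h h5

lemma rline_continuous : Continuous rline := by unfold rline; fun_prop

lemma rline_log_le (u : ℝ) : ‖Complex.log (rline u)‖ ≤ |u| + 7 := by
  have h1 := Complex.norm_le_abs_re_add_abs_im (Complex.log (rline u))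
  rw [Complex.log_re, Complex.log_im] at h1
  have h2 := Complex.abs_arg_le_pi (rline u)
  have h3 := Real.pi_le_four
  have h0 := rline_norm_ge u
  have hpos : 0 < ‖rline u‖ := by linarith
  have h4 : Real.log ‖rline u‖ ≤ |u| := by
    have := Real.log_le_sub_one_of_pos hpos
    linarith [rline_norm_le u]
  have h5 : -3 ≤ Real.log ‖rline u‖ := by
    have := Real.one_sub_inv_le_log_of_pos hpos
    have h6 : ‖rline u‖⁻¹ ≤ 4 := by
      rw [inv_le_comm₀ hpos (by norm_num)]; linarith
    linarith
  have h6 : |Real.log ‖rline u‖| ≤ |u| + 3 := by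
    rw [abs_le]; constructor <;> linarith [abs_nonneg u]
  linarith

/-- weight in the integral for `R` -/
noncomputable def W (u : ℝ) : ℂ := cexp (Real.pi * I * (rline u) ^ 2) / D (rline u)

lemma W_continuous : Continuous W := by
  unfold W
  refine Continuous.div ?_ (D_continuous.comp rline_continuous) D_rline_ne
  have := rline_continuous
  fun_prop

lemma W_norm (u : ℝ) : ‖W u‖ ≤ Real.exp (-Real.pi * u ^ 2 + 4 * |u|) := by
  unfold W
  rw [norm_div, Complex.norm_exp]
  have e : (Real.pi * I * (rline u) ^ 2).re = -2 * Real.pi * (rline u).re * (rline u).im := by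
    have : (Real.pi * I * (rline u) ^ 2 : ℂ) = (Real.pi : ℝ) * (I * (rline u) ^ 2) := by ring
    rw [this, Complex.re_ofReal_mul, Complex.I_mul_re, pow_two, Complex.mul_im]; ring
  have hs : Real.sqrt 2 * Real.sqrt 2 = 2 := Real.mul_self_sqrt (by norm_num)
  have hs2 : Real.sqrt 2 ≤ 2 := by nlinarith [Real.sqrt_nonneg 2]
  have hp := Real.pi_pos
  have e2 : -2 * Real.pi * (1 / 2 - Real.sqrt 2 / 2 * u) * (-(Real.sqrt 2 / 2 * u)) =
      -Real.pi * u ^ 2 + Real.pi * (Real.sqrt 2 / 2) * u := by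
    linear_combination (-(Real.pi * u ^ 2 / 2)) * hs
  rw [e, rline_re, rline_im, e2]
  have h1 : Real.pi * (Real.sqrt 2 / 2) * u ≤ 4 * |u| := by
    have h2 : Real.pi * (Real.sqrt 2 / 2) ≤ 4 := by nlinarith [Real.pi_le_four, Real.sqrt_nonneg 2]
    calc _ ≤ Real.pi * (Real.sqrt 2 / 2) * |u| := by gcongr; exact le_abs_self u
      _ ≤ _ := by gcongr
  have h2 := D_rline_ge u
  rw [div_le_iff₀ (by linarith)]
  have h3 : Real.exp (-Real.pi * u ^ 2 + Real.pi * (Real.sqrt 2 / 2) * u) ≤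
    Real.exp (-Real.pi * u ^ 2 + 4 * |u|) := by gcongr
  have := Real.exp_pos (-Real.pi * u ^ 2 + 4 * |u|)
  nlinarith

lemma R_eq (s : ℂ) : RiemannR s =
    -om * ∫ u : ℝ, cexp (s * (-Complex.log (rline u))) * W u := by
  unfold RiemannR
  change -om * _ = _
  congr 1
  apply integral_congr_ae
  refine Eventually.of_forall fun u => ?_
  beta_reduce
  rw [Complex.cpow_def_of_ne_zero (rline_ne u), mul_div_assoc]
  change _ * W u = _
  congr 2
  ring

lemma exp_log_bound (s : ℂ) (u : ℝ) : ‖cexp (s * (-Complex.log (rline u)))‖ ≤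
    Real.exp (‖s‖ * (|u| + 7)) := by
  refine (Complex.norm_exp_le_exp_norm _).trans ?_
  rw [norm_mul, norm_neg]
  gcongr
  exact rline_log_le u

lemma log_continuous : Continuous (fun u : ℝ => Complex.log (rline u)) :=
  rline_continuous.clog rline_slit

lemma R_integrable (s : ℂ) :
    Integrable (fun u : ℝ => cexp (s * (-Complex.log (rline u))) * W u) := by
  refine Integrable.mono' (gauss_int (‖s‖ + 4) (7 * ‖s‖)) ?_ (Eventually.of_forall fun u => ?_)
  · apply Continuous.aestronglyMeasurable
    have := log_continuous
    have := W_continuous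
    fun_prop
  · rw [norm_mul]
    refine (mul_le_mul (exp_log_bound s u) (W_norm u) (norm_nonneg _) (Real.exp_pos _).le).trans ?_
    rw [← Real.exp_add]
    apply le_of_eq; congr 1; ring

lemma R_differentiable : Differentiable ℂ RiemannR := by
  have : RiemannR = fun s => -om * ∫ u : ℝ, cexp (s * (-Complex.log (rline u))) * W u :=
    funext R_eq
  rw [this]
  intro s
  apply DifferentiableAt.const_mul
  refine differentiableAt_integral_exp (fun u : ℝ => -Complex.log (rline u)) W
    log_continuous.neg.aestronglyMeasurable W_continuous.aestronglyMeasurable s 1 one_pos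
    (fun u => Real.exp (-Real.pi * u ^ 2 + (‖s‖ + 6) * |u| + 7 * (‖s‖ + 2)))
    (gauss_int _ _) (R_integrable s) (Eventually.of_forall fun u z hz => ?_)
  have hz2 : ‖z‖ ≤ ‖s‖ + 1 := by
    rw [Metric.mem_ball, dist_eq_norm] at hz
    have := norm_le_norm_add_norm_sub' z s
    linarith
  rw [norm_mul, norm_mul, norm_neg]
  have h1 := exp_log_bound z u
  have h2 : Real.exp (‖z‖ * (|u| + 7)) ≤ Real.exp ((‖s‖ + 1) * (|u| + 7)) := by gcongr
  have h3 : ‖Complex.log (rline u)‖ ≤ Real.exp (|u| + 7) :=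
    (rline_log_le u).trans (by linarith [Real.add_one_le_exp (|u| + 7)])
  calc _ ≤ Real.exp ((‖s‖ + 1) * (|u| + 7)) * Real.exp (|u| + 7) *
        Real.exp (-Real.pi * u ^ 2 + 4 * |u|) := by
        gcongr
        · exact h1.trans h2
        · exact W_norm u
    _ = _ := by rw [← Real.exp_add, ← Real.exp_add]; congr 1; ring

end RSaux
namespace RSaux
open Complex Set Filter Topology

lemma polar_cpow (a θ v : ℝ) (hv : 0 < v) (h1 : -Real.pi < θ) (h2 : θ ≤ Real.pi) :
    (cexp (θ * I) * v) ^ (a : ℂ) = cexp (θ * I * a) * (v : ℂ) ^ (a : ℂ) := by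
  have hv0 : (v : ℂ) ≠ 0 := by exact_mod_cast hv.ne'
  have him : ((Real.log v : ℂ) + θ * I).im = θ := by simp
  have hl : Complex.log (cexp (θ * I) * v) = (Real.log v : ℂ) + θ * I := by
    rw [← Complex.log_exp (x := (Real.log v : ℂ) + θ * I) (by rw [him]; exact h1)
      (by rw [him]; exact h2), Complex.exp_add, Complex.ofReal_log hv.le, Complex.exp_log hv0, mul_comm]
  rw [Complex.cpow_def_of_ne_zero (mul_ne_zero (Complex.exp_ne_zero _) hv0),
    Complex.cpow_def_of_ne_zero hv0, hl, ← Complex.exp_add, Complex.ofReal_log hv.le]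
  congr 1; ring

lemma om_mul_cpow (a v : ℝ) (hv : 0 < v) :
    (om * v) ^ (a : ℂ) = cexp (Real.pi * I / 4 * a) * (v : ℂ) ^ (a : ℂ) := by
  have hp := Real.pi_pos
  have := polar_cpow a (Real.pi / 4) v hv (by linarith) (by linarith)
  have e : (((Real.pi / 4 : ℝ) : ℂ) * I) = Real.pi * I / 4 := by push_cast; ring
  rw [e] at this
  exact this

lemma neg_om_mul_cpow (a v : ℝ) (hv : 0 < v) :
    (-om * v) ^ (a : ℂ) = cexp (-(3 * Real.pi * I / 4) * a) * (v : ℂ) ^ (a : ℂ) := by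
  have hp := Real.pi_pos
  have := polar_cpow a (-(3 * Real.pi / 4)) v hv (by linarith) (by linarith)
  have e : (((-(3 * Real.pi / 4) : ℝ) : ℂ) * I) = -(3 * Real.pi * I / 4) := by push_cast; ring
  rw [e] at this
  have e2 : cexp (-(3 * Real.pi * I / 4)) = -om := by
    have : (-(3 * Real.pi * I / 4) : ℂ) = Real.pi * I / 4 - Real.pi * I := by ring
    rw [this, Complex.exp_sub, Complex.exp_pi_mul_I]
    unfold om
    ring
  rw [e2] at this
  exact this

/-- the rotated integrand -/
noncomputable def fR (a : ℝ) (z : ℂ) : ℂ :=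
  (-om * z) ^ (a : ℂ) / D (-om * z) * cexp (-(Real.pi * z ^ 2))

lemma D_om_strip_ne {z : ℂ} (hz : |z.im| < 1 / 2) (h0 : z ≠ 0) : D (-om * z) ≠ 0 := by
  have h := D_strip_ne (z := (starRingEnd ℂ) z) (by rw [Complex.conj_im, abs_neg]; exact hz)
    (by simpa using h0)
  intro h1
  apply h
  have h2 := D_conj (-om * z)
  rw [h1, map_zero, map_mul, map_neg, ← omb_eq_conj] at h2
  exact (neg_eq_zero.1 h2.symm)

lemma D_hasDerivAt : HasDerivAt D (2 * Real.pi * I) 0 := by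
  have h1 : HasDerivAt (fun z : ℂ => Real.pi * I * z) (Real.pi * I) 0 := by
    simpa using (hasDerivAt_id (0 : ℂ)).const_mul (Real.pi * I : ℂ)
  have := h1.cexp.sub h1.neg.cexp
  refine (this.congr_deriv ?_)
  rw [Pi.neg_apply, mul_zero, neg_zero, Complex.exp_zero]
  ring

lemma g_zero (a : ℝ) (ha : 1 < a) :
    ContinuousAt (fun w : ℂ => w ^ (a : ℂ) / D w) 0 := by
  rw [continuousAt_iff_punctured_nhds]
  have hD0 : D 0 = 0 := by unfold D; simp
  have h1 := D_hasDerivAt.tendsto_slope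
  have h2 : Tendsto (fun w : ℂ => w ^ ((a - 1 : ℝ) : ℂ)) (𝓝[≠] 0) (𝓝 0) := by
    have : ContinuousAt (fun w : ℂ => w ^ ((a - 1 : ℝ) : ℂ)) 0 :=
      Complex.continuousAt_cpow_const_of_re_pos (Or.inl le_rfl) (by rw [ofReal_re]; linarith)
    have h3 := this.tendsto.mono_left (nhdsWithin_le_nhds (s := {0}ᶜ))
    rw [Complex.zero_cpow (by exact_mod_cast (by linarith : a - 1 ≠ 0))] at h3
    exact h3
  have h3 := h2.mul (h1.inv₀ (by simp [Real.pi_ne_zero]))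
  rw [zero_mul] at h3
  rw [hD0, div_zero]
  refine h3.congr' ?_
  filter_upwards [self_mem_nhdsWithin] with w hw
  have hw : w ≠ 0 := hw
  rw [slope_def_field, hD0, sub_zero, sub_zero, inv_div]
  push_cast
  rw [Complex.cpow_sub _ _ hw, Complex.cpow_one]
  field_simp

lemma neg_om_re (z : ℂ) : (-om * z).re = -(Real.sqrt 2 / 2) * (z.re - z.im) := by
  rw [Complex.mul_re, Complex.neg_re, Complex.neg_im, om_re, om_im]; ring

lemma neg_om_im (z : ℂ) : (-om * z).im = -(Real.sqrt 2 / 2) * (z.re + z.im) := by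
  rw [Complex.mul_im, Complex.neg_re, Complex.neg_im, om_re, om_im]; ring

lemma neg_om_slit {z : ℂ} (hz : 0 ≤ z.im) (h0 : z ≠ 0) : -om * z ∈ slitPlane := by
  rw [Complex.mem_slitPlane_iff, neg_om_re, neg_om_im]
  have hs : 0 < Real.sqrt 2 / 2 := by positivity
  by_contra! h
  obtain ⟨h1, h2⟩ := h
  have h3 : z.re + z.im = 0 := by
    rcases mul_eq_zero.1 h2 with h | h
    · linarith
    · exact h
  have h4 : z.im = 0 := by nlinarith
  apply h0
  apply Complex.ext
  · rw [zero_re]; linarith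
  · rw [zero_im]; exact h4

lemma fR_diffAt (a : ℝ) {z : ℂ} (hz : 0 ≤ z.im) (hz2 : z.im < 1 / 2) (h0 : z ≠ 0) :
    DifferentiableAt ℂ (fR a) z := by
  unfold fR
  have h1 : DifferentiableAt ℂ (fun z : ℂ => -om * z) z := by fun_prop
  refine (DifferentiableAt.div (h1.cpow_const (neg_om_slit hz h0)) ?_ ?_).mul (by fun_prop)
  · exact (D_differentiable _).comp z h1
  · exact D_om_strip_ne (by rw [abs_of_nonneg hz]; exact hz2) h0

lemma fR_zero (a : ℝ) (ha : 1 < a) : ContinuousAt (fR a) 0 := by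
  unfold fR
  refine ContinuousAt.mul ?_ (by fun_prop)
  have h1 : ContinuousAt (fun z : ℂ => -om * z) 0 := by fun_prop
  have h2 : ContinuousAt (fun w : ℂ => w ^ (a : ℂ) / D w) (-om * 0) := by
    rw [mul_zero]; exact g_zero a ha
  exact ContinuousAt.comp (f := fun z : ℂ => -om * z) h2 h1

lemma fR_pos (a v : ℝ) (hv : 0 < v) : fR a v = -cexp (-(3 * Real.pi * I / 4) * a) *
    ((v : ℂ) ^ (a : ℂ) * (cexp (-(Real.pi * v ^ 2)) / D (om * v))) := by
  unfold fR
  rw [neg_om_mul_cpow a v hv, neg_mul om, D_neg]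
  ring

lemma fR_neg (a v : ℝ) (hv : 0 < v) : fR a ((-v : ℝ) : ℂ) = cexp (Real.pi * I / 4 * a) *
    ((v : ℂ) ^ (a : ℂ) * (cexp (-(Real.pi * v ^ 2)) / D (om * v))) := by
  unfold fR
  have : -om * ((-v : ℝ) : ℂ) = om * v := by push_cast; ring
  rw [this, om_mul_cpow a v hv]
  push_cast
  rw [neg_sq]
  ring

lemma fR_int_pos (a : ℝ) (ha : 0 < a) : IntegrableOn (fun x : ℝ => fR a x) (Ioi 0) :=
  IntegrableOn.congr_fun ((J_int a ha).const_mul (-cexp (-(3 * Real.pi * I / 4) * a)))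
    (fun v hv => (fR_pos a v hv).symm) measurableSet_Ioi

lemma fR_int_neg (a : ℝ) (ha : 0 < a) :
    IntegrableOn (fun x : ℝ => fR a ((-x : ℝ) : ℂ)) (Ioi 0) :=
  IntegrableOn.congr_fun ((J_int a ha).const_mul (cexp (Real.pi * I / 4 * a)))
    (fun v hv => (fR_neg a v hv).symm) measurableSet_Ioi

lemma fR_int_Iic (a : ℝ) (ha : 0 < a) : IntegrableOn (fun x : ℝ => fR a x) (Iic 0) := by
  have h := fR_int_neg a ha
  rw [integrableOn_Iic_iff_integrableOn_Iio]
  have := h.comp_neg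
  simpa using this

lemma fR_integrable (a : ℝ) (ha : 0 < a) : Integrable (fun x : ℝ => fR a x) := by
  rw [← integrableOn_univ, ← Iic_union_Ioi (a := (0 : ℝ))]
  exact (fR_int_Iic a ha).union (fR_int_pos a ha)

lemma fR_integral (a : ℝ) (ha : 0 < a) : ∫ x : ℝ, fR a x =
    (cexp (Real.pi * I / 4 * a) - cexp (-(3 * Real.pi * I / 4) * a)) * J a := by
  rw [← intervalIntegral.integral_Iic_add_Ioi (b := 0) (fR_int_Iic a ha) (fR_int_pos a ha)]
  have h := integral_comp_neg_Ioi 0 (fun x : ℝ => fR a x)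
  rw [neg_zero] at h
  rw [← h, setIntegral_congr_fun measurableSet_Ioi (fun v hv => fR_neg a v hv),
    setIntegral_congr_fun measurableSet_Ioi (fun v hv => fR_pos a v hv), integral_const_mul,
    integral_const_mul]
  unfold J
  ring

lemma rline_rot (u : ℝ) : rline u = -om * (((u - hh : ℝ) : ℂ) + hh * I) := by
  rw [rline_eq]
  push_cast
  linear_combination om * omb_half - (1 / 2 : ℂ) * om_mul_omb

lemma fR_line (a u : ℝ) : fR a (((u - hh : ℝ) : ℂ) + hh * I) =
    cexp (-(a : ℂ) * (-Complex.log (rline u))) * W u := by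
  unfold fR W
  rw [← rline_rot, Complex.cpow_def_of_ne_zero (rline_ne u)]
  have e : cexp (-(Real.pi * (((u - hh : ℝ) : ℂ) + hh * I) ^ 2)) = cexp (Real.pi * I * rline u ^ 2) := by
    congr 1
    rw [rline_rot, mul_pow, neg_sq, om_sq]
    linear_combination (-(Real.pi * (((u - hh : ℝ) : ℂ) + hh * I) ^ 2)) * I_sq
  rw [e]
  have e2 : -(a : ℂ) * (-Complex.log (rline u)) = Complex.log (rline u) * a := by ring
  rw [e2]
  ring

lemma fR_bound (a : ℝ) (ha : 0 < a) (T x y : ℝ) (hT : 1 ≤ T) (hx : |x| = T) (h0 : 0 ≤ y)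
    (h1 : y ≤ hh) : ‖fR a ((x : ℂ) + y * I)‖ ≤ Real.exp (-Real.pi * T ^ 2 + a * T + Real.pi) := by
  have hp := Real.pi_pos
  have hy := hh_lt
  have hzre : ((x : ℂ) + y * I).re = x := by simp
  have hzim : ((x : ℂ) + y * I).im = y := by simp
  have hD : 1 ≤ ‖D (-om * ((x : ℂ) + y * I))‖ := by
    refine le_trans ?_ (D_norm_ge _)
    rw [neg_om_im, hzre, hzim]
    have := abs_im_big x y (by rw [hx]; exact hT) (by rw [abs_of_nonneg h0]; linarith) (-1) (by norm_num)
    rw [neg_mul, abs_neg]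
    have e : √2 / 2 * (y - -1 * x) = √2 / 2 * (x + y) := by ring
    rw [e] at this
    exact this
  unfold fR
  rw [norm_mul, norm_div, Complex.norm_cpow_real, norm_mul, norm_neg, om_norm, one_mul,
    Complex.norm_exp]
  have hn : ‖(x : ℂ) + y * I‖ ≤ Real.exp T := by
    have := Complex.norm_le_abs_re_add_abs_im ((x : ℂ) + y * I)
    rw [hzre, hzim, hx, abs_of_nonneg h0] at this
    linarith [Real.add_one_le_exp T]
  have e1 : ‖(x : ℂ) + y * I‖ ^ a ≤ Real.exp (a * T) := by
    refine (Real.rpow_le_rpow (norm_nonneg _) hn ha.le).trans ?_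
    rw [← Real.exp_mul, mul_comm]
  have e2 : (-(Real.pi * ((x : ℂ) + y * I) ^ 2)).re ≤ -Real.pi * T ^ 2 + Real.pi := by
    rw [Complex.neg_re, Complex.re_ofReal_mul, pow_two, Complex.mul_re, hzre, hzim, ← hx, sq_abs]
    have : y * y ≤ 1 := by nlinarith
    nlinarith
  have e3 : ‖(x : ℂ) + y * I‖ ^ a / ‖D (-om * ((x : ℂ) + y * I))‖ ≤ Real.exp (a * T) :=
    (div_le_self (Real.rpow_nonneg (norm_nonneg _) _) hD).trans e1
  calc _ ≤ Real.exp (a * T) * Real.exp (-Real.pi * T ^ 2 + Real.pi) := by gcongr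
    _ = _ := by rw [← Real.exp_add]; congr 1; ring

lemma collapse (a : ℝ) (ha : 1 < a) : RiemannR (-(a : ℂ)) =
    -om * ((cexp (Real.pi * I / 4 * a) - cexp (-(3 * Real.pi * I / 4) * a)) * J a) := by
  have ha0 : 0 < a := by linarith
  have hintegr := R_integrable (-(a : ℂ))
  simp_rw [← fR_line] at hintegr
  have i2 : Integrable (fun x : ℝ => fR a (x + hh * I)) := by
    have := hintegr.comp_add_right hh
    simpa using this
  rw [R_eq]
  simp_rw [← fR_line]
  rw [integral_sub_right_eq_self (fun x : ℝ => fR a ((x : ℂ) + hh * I)), ← fR_integral a ha0]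
  congr 1
  have hhlt := hh_lt
  have main := line_shift (fR a) 0 hh hh_pos.le ?_ ?_
    (fun T => Real.exp (-Real.pi * T ^ 2 + a * T + Real.pi)) (gauss_tendsto a Real.pi)
    (fun T hT y h0 h1 => fR_bound a ha0 T T y hT (abs_of_nonneg (by linarith)) h0 h1)
    (fun T hT y h0 h1 => fR_bound a ha0 T (-T) y hT (by rw [abs_neg, abs_of_nonneg (by linarith)]) h0 h1)
    (by simpa using fR_integrable a ha0) i2
  · rw [← main]; simp
  · intro z hz
    by_cases h : z = 0
    · rw [h]; exact (fR_zero a ha).continuousWithinAt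
    · exact (fR_diffAt a hz.1 (by linarith [hz.2]) h).continuousAt.continuousWithinAt
  · intro z hz
    refine (fR_diffAt a hz.1.le (by linarith [hz.2]) ?_).differentiableWithinAt
    intro h
    have := hz.1
    rw [h, zero_im] at this
    exact lt_irrefl _ this

end RSaux
namespace RSaux
open Complex Set Filter Topology

lemma trig_id (a : ℂ) : -om * (cexp (Real.pi * I / 4 * a) - cexp (-(3 * Real.pi * I / 4) * a)) *
    cexp (Real.pi * I / 4 * (a + 1)) = -(2 * Complex.cos (Real.pi * (a + 1) / 2)) := by
  rw [Complex.two_cos]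
  have h1 : om * cexp (Real.pi * I / 4 * a) * cexp (Real.pi * I / 4 * (a + 1)) =
      cexp (Real.pi * (a + 1) / 2 * I) := by
    unfold om
    rw [← Complex.exp_add, ← Complex.exp_add]; congr 1; ring
  have h2 : om * cexp (-(3 * Real.pi * I / 4) * a) * cexp (Real.pi * I / 4 * (a + 1)) =
      -cexp (-(Real.pi * (a + 1) / 2) * I) := by
    have : -cexp (-(Real.pi * (a + 1) / 2) * I) =
        cexp (Real.pi * I) * cexp (-(Real.pi * (a + 1) / 2) * I) := by
      rw [Complex.exp_pi_mul_I]; ring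
    unfold om
    rw [this, ← Complex.exp_add, ← Complex.exp_add, ← Complex.exp_add]; congr 1; ring
  linear_combination -h1 + h2

lemma fe_real (x : ℝ) (hx : 2 < x) : riemannZeta (1 - x) = RiemannR (1 - x) +
    2 * (2 * Real.pi : ℂ) ^ (-(x : ℂ)) * Complex.Gamma x * Complex.cos (Real.pi * x / 2) *
      (starRingEnd ℂ) (RiemannR ((starRingEnd ℂ) (x : ℂ))) := by
  have h1 := collapse (x - 1) (by linarith)
  rw [J_eq (x - 1) (by linarith)] at h1
  have h2 := trig_id ((x - 1 : ℝ) : ℂ)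
  have e1 : (((x - 1 : ℝ) : ℂ) + 1) = x := by push_cast; ring
  have e2 : (-((x - 1 : ℝ) : ℂ)) = 1 - x := by push_cast; ring
  rw [e1] at h1 h2
  rw [e2] at h1
  rw [Complex.conj_ofReal]
  have h3 := riemannZeta_one_sub (s := (x : ℂ)) (by
    intro n h
    have := congrArg Complex.re h
    simp at this
    have hn : (0 : ℝ) ≤ n := Nat.cast_nonneg n
    linarith) (by
    intro h
    have : x = 1 := by exact_mod_cast h
    linarith)
  rw [h3, h1]
  linear_combination (-((2 * Real.pi : ℂ) ^ (-(x : ℂ)) * Complex.Gamma x *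
    ((starRingEnd ℂ) (RiemannR x) - riemannZeta x))) * h2

lemma fe (s : ℂ) (hs : 0 < s.re) : riemannZeta (1 - s) = RiemannR (1 - s) +
    2 * (2 * Real.pi : ℂ) ^ (-s) * Complex.Gamma s * Complex.cos (Real.pi * s / 2) *
      (starRingEnd ℂ) (RiemannR ((starRingEnd ℂ) s)) := by
  refine eq_of_real (fun s => riemannZeta (1 - s)) (fun s => RiemannR (1 - s) +
    2 * (2 * Real.pi : ℂ) ^ (-s) * Complex.Gamma s * Complex.cos (Real.pi * s / 2) *
      (starRingEnd ℂ) (RiemannR ((starRingEnd ℂ) s))) ?_ ?_ 2 (by norm_num) fe_real s hs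
  · intro z hz
    have hz : 0 < z.re := hz
    apply DifferentiableAt.differentiableWithinAt
    have h1 : (1 - z) ≠ 1 := by
      intro h
      have : z = 0 := by linear_combination -h
      rw [this, zero_re] at hz
      exact lt_irrefl _ hz
    exact (differentiableAt_riemannZeta h1).comp z (by fun_prop)
  · intro z hz
    have hz : 0 < z.re := hz
    apply DifferentiableAt.differentiableWithinAt
    have h1 : DifferentiableAt ℂ (fun s => RiemannR (1 - s)) z :=
      (R_differentiable _).comp z (by fun_prop)
    have h2 : DifferentiableAt ℂ Complex.Gamma z := by
      apply Complex.differentiableAt_Gamma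
      intro m h
      rw [h] at hz
      simp at hz
      have hn : (0 : ℝ) ≤ m := Nat.cast_nonneg m
      linarith
    have h3 : DifferentiableAt ℂ (fun s => (starRingEnd ℂ) (RiemannR ((starRingEnd ℂ) s))) z := by
      have := (R_differentiable ((starRingEnd ℂ) z)).conj_conj
      rw [Complex.conj_conj] at this
      exact this
    have h4 : DifferentiableAt ℂ (fun s : ℂ => (2 * Real.pi : ℂ) ^ (-s)) z := by
      refine DifferentiableAt.const_cpow (by fun_prop) (Or.inl ?_)
      simp [Real.pi_ne_zero]
    refine h1.add ((((h4.const_mul 2).mul h2).mul ?_).mul h3)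
    have : DifferentiableAt ℂ (fun s : ℂ => (Real.pi * s / 2 : ℂ)) z := by fun_prop
    exact this.ccos

lemma Gammaℝ_conj (s : ℂ) : Complex.Gammaℝ ((starRingEnd ℂ) s) = (starRingEnd ℂ) (Complex.Gammaℝ s) := by
  rw [Complex.Gammaℝ_def, Complex.Gammaℝ_def, map_mul, ← Complex.Gamma_conj]
  have hp : (Real.pi : ℂ) ≠ 0 := by exact_mod_cast Real.pi_ne_zero
  congr 1
  · rw [Complex.cpow_def_of_ne_zero hp, Complex.cpow_def_of_ne_zero hp, ← Complex.exp_conj,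
      ← Complex.ofReal_log Real.pi_pos.le]
    simp [Complex.conj_ofNat]
  · simp [Complex.conj_ofNat]

lemma completed (t : ℝ) (s : ℂ) (hs : s = 1 / 2 + I * t) :
    Complex.Gammaℝ s * riemannZeta s =
      ((2 * (Complex.Gammaℝ s * RiemannR s).re : ℝ) : ℂ) := by
  have hc : (starRingEnd ℂ) s = 1 - s := by
    rw [hs]; simp [Complex.conj_ofNat]; norm_num; ring
  have hre : s.re = 1 / 2 := by rw [hs]; simp
  have hre' : (1 - s).re = 1 / 2 := by rw [sub_re, hre, one_re]; norm_num
  have h := fe (1 - s) (by rw [hre']; norm_num)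
  have hc2 : (starRingEnd ℂ) (1 - s) = s := by rw [← hc, Complex.conj_conj]
  rw [sub_sub_cancel, hc2] at h
  have h2 := Complex.inv_Gammaℝ_one_sub (s := 1 - s) (by
    intro n hn
    have := congrArg Complex.re hn
    rw [hre'] at this
    simp at this
    have hn : (0 : ℝ) ≤ n := Nat.cast_nonneg n
    linarith)
  rw [sub_sub_cancel, Complex.Gammaℂ_def] at h2
  have hG : Complex.Gammaℝ s ≠ 0 := Complex.Gammaℝ_ne_zero_of_re_pos (by rw [hre]; norm_num)
  have hG' : Complex.Gammaℝ (1 - s) ≠ 0 :=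
    Complex.Gammaℝ_ne_zero_of_re_pos (by rw [hre']; norm_num)
  have h3 := Gammaℝ_conj s
  rw [hc] at h3
  have h4 : Complex.Gammaℝ s * (2 * (2 * Real.pi : ℂ) ^ (-(1 - s)) * Complex.Gamma (1 - s) *
      Complex.cos (Real.pi * (1 - s) / 2)) = (starRingEnd ℂ) (Complex.Gammaℝ s) := by
    rw [← h3]
    rw [inv_eq_iff_eq_inv, mul_inv, inv_inv] at h2
    set X := 2 * (2 * Real.pi : ℂ) ^ (-(1 - s)) * Complex.Gamma (1 - s) *
      Complex.cos (Real.pi * (1 - s) / 2) with hX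
    have hX0 : X ≠ 0 := by
      intro h0
      apply hG
      rw [h2, h0, inv_zero, zero_mul]
    rw [h2]
    field_simp
  rw [h, mul_add]
  have h5 := Complex.add_conj (Complex.Gammaℝ s * RiemannR s)
  rw [map_mul, ← h4] at h5
  rw [← h5]
  ring

end RSaux

/-- For `s = 1/2 + it`, the Riemann xi value
`ξ(s) = (1/2) s (s−1) π^{−s/2} Γ(s/2) ζ(s)` is real and
`Re (π^{−s/2} Γ(s/2) R(s)) = − Re ξ(1/2+it) / (1/4 + t²)`. -/
theorem re_completed_R_eq_neg_Xi_div (t : ℝ) :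
    let s : ℂ := 1 / 2 + Complex.I * t
    let xi : ℂ := (1 / 2) * s * (s - 1) * (Real.pi : ℂ) ^ (-s / 2) *
      Complex.Gamma (s / 2) * riemannZeta s
    xi.im = 0 ∧
      ((Real.pi : ℂ) ^ (-s / 2) * Complex.Gamma (s / 2) * RiemannR s).re =
        -xi.re / (1 / 4 + t ^ 2) := by
  intro s xi
  have h := RSaux.completed t s rfl
  have hs : s * (s - 1) = ((-(1 / 4 + t ^ 2) : ℝ) : ℂ) := by
    show (1 / 2 + Complex.I * t : ℂ) * (1 / 2 + Complex.I * t - 1) = _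
    push_cast
    linear_combination (t ^ 2 : ℂ) * Complex.I_sq
  have hxi : xi = ((-(1 / 4 + t ^ 2) * (Complex.Gammaℝ s * RiemannR s).re : ℝ) : ℂ) := by
    have e : xi = (1 / 2) * (s * (s - 1)) * (Complex.Gammaℝ s * riemannZeta s) := by
      show (1 / 2) * s * (s - 1) * (Real.pi : ℂ) ^ (-s / 2) *
        Complex.Gamma (s / 2) * riemannZeta s = _
      rw [Complex.Gammaℝ_def]; ring
    rw [e, h, hs]
    push_cast
    ring
  rw [hxi]
  refine ⟨Complex.ofReal_im _, ?_⟩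
  rw [Complex.ofReal_re, ← Complex.Gammaℝ_def]
  have : (1 / 4 + t ^ 2 : ℝ) ≠ 0 := by positivity
  field_simp
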